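/- arXiv:1706.00817 — 7 statements merged into one kernel-verified Lean document; each statement's English description precedes it below -/
import Mathlib

section
/- The conjugation action of S₃ on the set of generic monodromy representations of B in S₃ has exactly 40 orbits. -/
/-- Generators of the braid group `B₂(C₂)` in Bellingeri's presentation. -/
inductive Gen : Type
  | a1 | a2 | b1 | b2 | s
  deriving DecidableEq

namespace Braid

open FreeGroup

abbrev A1 : FreeGroup Gen := FreeGroup.of Gen.a1
abbrev A2 : FreeGroup Gen := FreeGroup.of Gen.a2
abbrev B1 : FreeGroup Gen := FreeGroup.of Gen.b1
abbrev B2 : FreeGroup Gen := FreeGroup.of Gen.b2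
abbrev Sg : FreeGroup Gen := FreeGroup.of Gen.s

/-- The eleven relations (R2), (R3), (R4), (TR) of Bellingeri's presentation,
written as words that are set equal to `1`. -/
def rels : Set (FreeGroup Gen) :=
  { Sg⁻¹ * A1 * Sg⁻¹ * A1 * (A1 * Sg⁻¹ * A1 * Sg⁻¹)⁻¹,
    Sg⁻¹ * A2 * Sg⁻¹ * A2 * (A2 * Sg⁻¹ * A2 * Sg⁻¹)⁻¹,
    Sg⁻¹ * B1 * Sg⁻¹ * B1 * (B1 * Sg⁻¹ * B1 * Sg⁻¹)⁻¹,
    Sg⁻¹ * B2 * Sg⁻¹ * B2 * (B2 * Sg⁻¹ * B2 * Sg⁻¹)⁻¹,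
    Sg⁻¹ * A1 * Sg * A2 * (A2 * Sg⁻¹ * A1 * Sg)⁻¹,
    Sg⁻¹ * B1 * Sg * B2 * (B2 * Sg⁻¹ * B1 * Sg)⁻¹,
    Sg⁻¹ * A1 * Sg * B2 * (B2 * Sg⁻¹ * A1 * Sg)⁻¹,
    Sg⁻¹ * B1 * Sg * A2 * (A2 * Sg⁻¹ * B1 * Sg)⁻¹,
    Sg⁻¹ * A1 * Sg⁻¹ * B1 * (B1 * Sg⁻¹ * A1 * Sg)⁻¹,
    Sg⁻¹ * A2 * Sg⁻¹ * B2 * (B2 * Sg⁻¹ * A2 * Sg)⁻¹,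
    (A1 * B1⁻¹ * A1⁻¹ * B1) * (A2 * B2⁻¹ * A2⁻¹ * B2) * (Sg * Sg)⁻¹ }

/-- The group `B`, isomorphic to the braid group `B₂(C₂)` on two strings
on a genus `2` surface. -/
abbrev B : Type := PresentedGroup rels

/-- The image of the generator `σ` in `B`. -/
def σB : B := PresentedGroup.of Gen.s

/-- A generic monodromy representation of `B` in `Sₙ`: a homomorphism
`φ : B → Sₙ` such that `φ(σ)` is a transposition and the image of `φ` is a
transitive subgroup of `Sₙ`. -/
def IsGeneric (n : ℕ) (φ : B →* Equiv.Perm (Fin n)) : Prop :=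
  (φ σB).IsSwap ∧ ∀ i j : Fin n, ∃ g : B, φ g i = j

end Braid

namespace Braid

open Equiv

/-- The rotation `i ↦ i + c` of `Fin 3`. -/
def rot (c : ZMod 3) : Perm (Fin 3) := finRotate 3 ^ c.val

/-- The assignment of the generators sending `σ` to the transposition `(0 1)` and the remaining
generators to rotations. -/
def rotAssign (v : Fin 4 → ZMod 3) : Gen → Perm (Fin 3)
  | .a1 => rot (v 0)
  | .a2 => rot (v 1)
  | .b1 => rot (v 2)
  | .b2 => rot (v 3)
  | .s => swap 0 1

/-- The first nonzero coordinate of `v` exists and equals `1`. -/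
def IsNormalized (v : Fin 4 → ZMod 3) : Prop :=
  v 0 = 1 ∨ v 0 = 0 ∧ (v 1 = 1 ∨ v 1 = 0 ∧ (v 2 = 1 ∨ v 2 = 0 ∧ v 3 = 1))

instance : DecidablePred IsNormalized := fun v => by unfold IsNormalized; infer_instance

lemma card_isNormalized : Fintype.card {v // IsNormalized v} = 40 := by decide +kernel

lemma isNormalized_or_neg : ∀ v : Fin 4 → ZMod 3, v ≠ 0 → IsNormalized v ∨ IsNormalized (-v) := by
  decide +kernel

lemma not_isNormalized_neg : ∀ v : Fin 4 → ZMod 3, IsNormalized v → ¬ IsNormalized (-v) := by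
  decide +kernel

lemma rot_injective : Function.Injective rot := by decide +kernel

lemma rot_zero : rot 0 = 1 := rfl

lemma exists_rot_of_sign_eq_one : ∀ x : Perm (Fin 3), Perm.sign x = 1 → ∃ c, rot c = x := by
  decide +kernel

lemma swap_conj_rot : ∀ c, swap 0 1 * rot c * (swap 0 1)⁻¹ = rot (-c) := by decide +kernel

lemma rot_transitive : ∀ c : ZMod 3, c ≠ 0 → ∀ i j, ∃ n : Fin 3, (rot c ^ (n : ℕ)) i = j := by
  decide +kernel

lemma eq_one_or_eq_swap_of_conj :
    ∀ τ : Perm (Fin 3), τ * swap 0 1 * τ⁻¹ = swap 0 1 → τ = 1 ∨ τ = swap 0 1 := by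
  decide +kernel

/-- The relations of `B` hold when `σ` is sent to `(0 1)` and the other generators to rotations. -/
lemma rot_relations : ∀ a b,
    (swap 0 1)⁻¹ * rot a * (swap 0 1)⁻¹ * rot a = rot a * (swap 0 1)⁻¹ * rot a * (swap 0 1)⁻¹ ∧
    (swap 0 1)⁻¹ * rot a * swap 0 1 * rot b = rot b * (swap 0 1)⁻¹ * rot a * swap 0 1 ∧
    (swap 0 1)⁻¹ * rot a * (swap 0 1)⁻¹ * rot b = rot b * (swap 0 1)⁻¹ * rot a * swap 0 1 ∧
    rot a * (rot b)⁻¹ * (rot a)⁻¹ * rot b = 1 := by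
  decide +kernel

/-- The relations force a generator with odd image, and with it its partner, to commute with `s`. -/
lemma commute_of_sign_ne_one : ∀ s : Perm (Fin 3), Perm.sign s = -1 → ∀ a b : Perm (Fin 3),
    s⁻¹ * a * s⁻¹ * a = a * s⁻¹ * a * s⁻¹ →
    s⁻¹ * b * s⁻¹ * b = b * s⁻¹ * b * s⁻¹ →
    s⁻¹ * a * s⁻¹ * b = b * s⁻¹ * a * s →
    (Perm.sign a = 1 ∧ Perm.sign b = 1) ∨ (Commute a s ∧ Commute b s ∧ (a = s ∨ b = s)) := by
  unfold Commute SemiconjBy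
  decide +kernel

lemma exists_common_fixedPoint : ∀ s : Perm (Fin 3), Perm.sign s = -1 →
    ∃ k, ∀ g : Perm (Fin 3), g * s = s * g → g k = k := by
  decide +kernel

lemma exists_conj_eq_swap : ∀ s : Perm (Fin 3), Perm.sign s = -1 →
    ∃ τ : Perm (Fin 3), τ * s * τ⁻¹ = swap 0 1 := by
  decide +kernel

lemma forall_rels_iff {G : Type*} [Group G] (f : Gen → G) :
    (∀ r ∈ rels, FreeGroup.lift f r = 1) ↔
      (∀ x ∈ [f .a1, f .a2, f .b1, f .b2],
        (f .s)⁻¹ * x * (f .s)⁻¹ * x = x * (f .s)⁻¹ * x * (f .s)⁻¹) ∧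
      (∀ x ∈ [f .a1, f .b1], ∀ y ∈ [f .a2, f .b2],
        (f .s)⁻¹ * x * f .s * y = y * (f .s)⁻¹ * x * f .s) ∧
      (f .s)⁻¹ * f .a1 * (f .s)⁻¹ * f .b1 = f .b1 * (f .s)⁻¹ * f .a1 * f .s ∧
      (f .s)⁻¹ * f .a2 * (f .s)⁻¹ * f .b2 = f .b2 * (f .s)⁻¹ * f .a2 * f .s ∧
      f .a1 * (f .b1)⁻¹ * (f .a1)⁻¹ * f .b1 * (f .a2 * (f .b2)⁻¹ * (f .a2)⁻¹ * f .b2) =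
        f .s * f .s := by
  simp only [rels, Set.mem_insert_iff, Set.mem_singleton_iff, forall_eq_or_imp, forall_eq,
    map_mul, map_inv, FreeGroup.lift_apply_of, mul_inv_eq_one, List.forall_mem_cons,
    List.not_mem_nil, false_imp_iff, implies_true, and_true]
  tauto

lemma rotAssign_rels (v : Fin 4 → ZMod 3) : ∀ r ∈ rels, FreeGroup.lift (rotAssign v) r = 1 := by
  rw [forall_rels_iff]
  simp only [rotAssign, List.forall_mem_cons, List.not_mem_nil, false_imp_iff, implies_true,
    and_true]
  have h := rot_relations
  refine ⟨⟨(h _ 0).1, (h _ 0).1, (h _ 0).1, (h _ 0).1⟩,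
    ⟨⟨(h _ _).2.1, (h _ _).2.1⟩, (h _ _).2.1, (h _ _).2.1⟩, (h _ _).2.2.1, (h _ _).2.2.1, ?_⟩
  rw [(h _ _).2.2.2, (h _ _).2.2.2, swap_mul_self, one_mul]

/-- The representation of `B` in `S₃` given by `rotAssign v`. -/
def rotHom (v : Fin 4 → ZMod 3) : B →* Perm (Fin 3) :=
  PresentedGroup.toGroup (rotAssign_rels v)

lemma rotHom_of (v : Fin 4 → ZMod 3) (x : Gen) :
    rotHom v (PresentedGroup.of x) = rotAssign v x :=
  PresentedGroup.toGroup.of (rotAssign_rels v)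

lemma exists_rotAssign_eq_rot (v : Fin 4 → ZMod 3) :
    ∀ i : Fin 4, ∃ x, rotAssign v x = rot (v i)
  | 0 => ⟨.a1, rfl⟩
  | 1 => ⟨.a2, rfl⟩
  | 2 => ⟨.b1, rfl⟩
  | 3 => ⟨.b2, rfl⟩

lemma isGeneric_rotHom {v : Fin 4 → ZMod 3} (hv : v ≠ 0) : IsGeneric 3 (rotHom v) := by
  refine ⟨⟨0, 1, by decide, rotHom_of v .s⟩, fun i j => ?_⟩
  obtain ⟨k, hk⟩ := Function.ne_iff.mp hv
  obtain ⟨x, hx⟩ := exists_rotAssign_eq_rot v k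
  obtain ⟨n, hn⟩ := rot_transitive _ hk i j
  exact ⟨PresentedGroup.of x ^ (n : ℕ), by rw [map_pow, rotHom_of, hx, hn]⟩

lemma IsNormalized.ne_zero {v : Fin 4 → ZMod 3} (hv : IsNormalized v) : v ≠ 0 := by
  rintro rfl
  exact not_isNormalized_neg 0 hv (by simpa using hv)

lemma swap_conj_rotHom (v : Fin 4 → ZMod 3) (g : B) :
    rotHom (-v) g = swap 0 1 * rotHom v g * (swap 0 1)⁻¹ := by
  suffices h : rotHom (-v) = (MulAut.conj (swap 0 1)).toMonoidHom.comp (rotHom v) from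
    DFunLike.congr_fun h g
  refine PresentedGroup.ext fun x => ?_
  change _ = swap 0 1 * rotHom v (PresentedGroup.of x) * (swap 0 1)⁻¹
  cases x <;> simp only [rotHom_of, rotAssign, swap_conj_rot, Pi.neg_apply]
  decide

lemma eq_of_rotHom_eq {v w : Fin 4 → ZMod 3} (h : ∀ g, rotHom v g = rotHom w g) : v = w := by
  funext i
  apply rot_injective
  have key (x : Gen) : rotAssign v x = rotAssign w x := by
    rw [← rotHom_of, ← rotHom_of, h]
  fin_cases i
  exacts [key .a1, key .a2, key .b1, key .b2]

lemma eq_of_conj_rotHom {v w : Fin 4 → ZMod 3} (hv : IsNormalized v) (hw : IsNormalized w)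
    {τ : Perm (Fin 3)} (h : ∀ g, rotHom w g = τ * rotHom v g * τ⁻¹) : v = w := by
  have hs : swap 0 1 = τ * swap 0 1 * τ⁻¹ := by
    simpa only [rotHom_of, rotAssign] using h (.of .s)
  obtain rfl | rfl := eq_one_or_eq_swap_of_conj τ hs.symm
  · exact eq_of_rotHom_eq fun g => by simpa using (h g).symm
  · have : -v = w := eq_of_rotHom_eq fun g => by rw [swap_conj_rotHom, h]
    exact absurd (this ▸ hw) (not_isNormalized_neg v hv)

lemma not_forall_commute {φ : B →* Perm (Fin 3)} (hφ : IsGeneric 3 φ) :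
    ¬ ∀ x : Gen, Commute (φ (.of x)) (φ σB) := by
  intro h
  obtain ⟨k, hk⟩ := exists_common_fixedPoint (φ σB) hφ.1.sign_eq
  have hcomm (g : B) : φ g ∈ Subgroup.centralizer {φ σB} := by
    have := PresentedGroup.generated_by rels ((Subgroup.centralizer {φ σB}).comap φ)
      fun x => by
        simpa [Subgroup.mem_centralizer_singleton_iff, eq_comm] using (h x).eq
    exact this g
  obtain ⟨g, hg⟩ := hφ.2 k (k + 1)
  rw [hk _ (by simpa [Subgroup.mem_centralizer_singleton_iff, eq_comm] using hcomm g)] at hg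
  clear hk
  revert k
  decide

lemma commute_of_conj_mul_self {G : Type*} [Group G] {s x : G}
    (h : s⁻¹ * x * s * s = s * s⁻¹ * x * s) : Commute x s := by
  have h' : s⁻¹ * x * s = x := by simpa using h
  rw [mul_assoc, inv_mul_eq_iff_eq_mul] at h'
  exact h'

lemma commute_of_self_conj_mul {G : Type*} [Group G] {s y : G}
    (h : s⁻¹ * s * s * y = y * s⁻¹ * s * s) : Commute y s := by
  simpa [Commute, SemiconjBy, eq_comm] using h

lemma sign_eq_one {φ : B →* Perm (Fin 3)} (hφ : IsGeneric 3 φ) {x : Gen} (hx : x ≠ .s) :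
    Perm.sign (φ (.of x)) = 1 := by
  have hrels := (forall_rels_iff fun x => φ (.of x)).mp fun r hr => by
    have : FreeGroup.lift (fun x => φ (.of x)) = φ.comp (PresentedGroup.mk rels) := by
      ext x; simp [PresentedGroup.of]
    rw [this, MonoidHom.comp_apply, PresentedGroup.one_of_mem hr, map_one]
  have hnot := not_forall_commute hφ
  have hsign := hφ.1.sign_eq
  simp only [List.forall_mem_cons, List.not_mem_nil, false_imp_iff, implies_true,
    and_true] at hrels
  change Perm.sign (φ (.of .s)) = -1 at hsign
  change ¬ ∀ x : Gen, Commute (φ (.of x)) (φ (.of .s)) at hnot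
  obtain ⟨⟨r1, r2, r3, r4⟩, ⟨⟨r5, r6⟩, r7, r8⟩, r9, r10, -⟩ := hrels
  have hcomm (h1 : Commute (φ (.of .a1)) (φ (.of .s))) (h2 : Commute (φ (.of .b1)) (φ (.of .s)))
      (h3 : Commute (φ (.of .a2)) (φ (.of .s))) (h4 : Commute (φ (.of .b2)) (φ (.of .s))) :
      False :=
    hnot fun | .a1 => h1 | .a2 => h3 | .b1 => h2 | .b2 => h4 | .s => Commute.refl _
  obtain ⟨sa1, sb1⟩ | ⟨ca1, cb1, h⟩ := commute_of_sign_ne_one _ hsign _ _ r1 r3 r9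
  · obtain ⟨sa2, sb2⟩ | ⟨ca2, cb2, h⟩ := commute_of_sign_ne_one _ hsign _ _ r2 r4 r10
    · cases x <;> first | exact absurd rfl hx | assumption
    · obtain h | h := h
      · rw [h] at r5 r7
        exact (hcomm (commute_of_conj_mul_self r5) (commute_of_conj_mul_self r7) ca2 cb2).elim
      · rw [h] at r6 r8
        exact (hcomm (commute_of_conj_mul_self r6) (commute_of_conj_mul_self r8) ca2 cb2).elim
  · obtain h | h := h
    · rw [h] at r5 r6
      exact (hcomm ca1 cb1 (commute_of_self_conj_mul r5) (commute_of_self_conj_mul r6)).elim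
    · rw [h] at r7 r8
      exact (hcomm ca1 cb1 (commute_of_self_conj_mul r7) (commute_of_self_conj_mul r8)).elim

lemma exists_conj_rotHom {φ : B →* Perm (Fin 3)} (hφ : IsGeneric 3 φ) :
    ∃ v, IsNormalized v ∧ ∃ τ : Perm (Fin 3), ∀ g, φ g = τ * rotHom v g * τ⁻¹ := by
  obtain ⟨τ, hτ⟩ := exists_conj_eq_swap (φ σB) hφ.1.sign_eq
  have hrot (x : Gen) (hx : x ≠ .s) : ∃ c, rot c = τ * φ (.of x) * τ⁻¹ :=
    exists_rot_of_sign_eq_one _ (by simp [sign_eq_one hφ hx])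
  obtain ⟨a₁, h1⟩ := hrot .a1 (by decide)
  obtain ⟨a₂, h2⟩ := hrot .a2 (by decide)
  obtain ⟨b₁, h3⟩ := hrot .b1 (by decide)
  obtain ⟨b₂, h4⟩ := hrot .b2 (by decide)
  have hconj : rotHom ![a₁, a₂, b₁, b₂] = (MulAut.conj τ).toMonoidHom.comp φ := by
    refine PresentedGroup.ext fun x => ?_
    rw [rotHom_of]
    cases x
    exacts [h1, h2, h3, h4, hτ.symm]
  generalize ![a₁, a₂, b₁, b₂] = v at hconj
  have hg (g : B) : rotHom v g = τ * φ g * τ⁻¹ := DFunLike.congr_fun hconj g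
  have hv : v ≠ 0 := by
    rintro rfl
    refine not_forall_commute hφ fun x => ?_
    by_cases hx : x = .s
    · subst hx; exact Commute.refl _
    · have h := hg (.of x)
      have h0 : rotHom 0 (.of x) = 1 := by
        cases x <;> first | exact absurd rfl hx | exact (rotHom_of 0 _).trans rot_zero
      rw [h0, eq_comm, mul_inv_eq_one, mul_eq_left] at h
      rw [h]
      exact Commute.one_left _
  obtain h | h := isNormalized_or_neg v hv
  · exact ⟨v, h, τ⁻¹, fun g => by rw [hg]; group⟩
  · exact ⟨-v, h, τ⁻¹ * (swap 0 1)⁻¹, fun g => by rw [swap_conj_rotHom, hg]; group⟩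

end Braid

open Braid

/-- The conjugation action of S₃ on the set of generic monodromy
representations of B in S₃ has exactly 40 orbits. -/
theorem stmt3 :
    Nat.card (Quot (fun (φ ψ : {φ : B →* Equiv.Perm (Fin 3) // IsGeneric 3 φ}) =>
      ∃ τ : Equiv.Perm (Fin 3), ∀ g : B, ψ.1 g = τ * φ.1 g * τ⁻¹)) = 40 := by
  have hbij : Function.Bijective fun v : {v // IsNormalized v} =>
      Quot.mk (fun (φ ψ : {φ : B →* Equiv.Perm (Fin 3) // IsGeneric 3 φ}) =>
        ∃ τ : Equiv.Perm (Fin 3), ∀ g : B, ψ.1 g = τ * φ.1 g * τ⁻¹)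
        ⟨rotHom v.1, isGeneric_rotHom v.2.ne_zero⟩ := by
    constructor
    · intro v w h
      have hequiv : Equivalence (fun (φ ψ : {φ : B →* Equiv.Perm (Fin 3) // IsGeneric 3 φ}) =>
          ∃ τ : Equiv.Perm (Fin 3), ∀ g : B, ψ.1 g = τ * φ.1 g * τ⁻¹) :=
        ⟨fun φ => ⟨1, by simp⟩,
          fun ⟨τ, h⟩ => ⟨τ⁻¹, fun g => by rw [h]; group⟩,
          fun ⟨τ, h⟩ ⟨τ', h'⟩ => ⟨τ' * τ, fun g => by rw [h', h]; group⟩⟩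
      obtain ⟨τ, hτ⟩ := hequiv.quot_mk_eq_iff _ _ |>.mp h
      exact Subtype.ext (eq_of_conj_rotHom v.2 w.2 hτ)
    · rintro ⟨φ, hφ⟩
      obtain ⟨v, hv, hτ⟩ := exists_conj_rotHom hφ
      exact ⟨⟨v, hv⟩, Quot.sound hτ⟩
  rw [← Nat.card_congr (Equiv.ofBijective _ hbij), Nat.card_eq_fintype_card, card_isNormalized]
end

section
/- There are exactly 2880 generic monodromy representations of B in S₄, i.e. the set of group homomorphisms φ: B → S₄ such that φ(σ) is a transposition and the image of φ is a transitive subgroup of S₄ has cardinality 2880. -/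
open Braid

namespace Braid

open Equiv (Perm)

/-! ### Encoding permutations of four letters by natural numbers

The value `p i` is the `i`-th digit of `code p` in base `4`. This makes the enumeration below
cheap enough for kernel evaluation. -/

/-- The `i`-th digit of `c` in base `4`. -/
def digit (c i : ℕ) : ℕ := c / 4 ^ i % 4

/-- The number whose base `4` digits are the values of `p`. -/
def code (p : Perm (Fin 4)) : ℕ := p 0 + 4 * p 1 + 16 * p 2 + 64 * p 3

/-- Composition of encoded permutations. -/
def codeMul (c d : ℕ) : ℕ :=
  digit c (digit d 0) + 4 * digit c (digit d 1) + 16 * digit c (digit d 2) +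
    64 * digit c (digit d 3)

/-- Inversion of encoded permutations. -/
def codeInv (c : ℕ) : ℕ := 4 ^ digit c 1 + 2 * 4 ^ digit c 2 + 3 * 4 ^ digit c 3

/-- The codes of all permutations of `Fin 4`. -/
def codes : List ℕ :=
  (List.range 256).filter fun c ↦ [0, 1, 2, 3].all fun i ↦ [0, 1, 2, 3].any fun j ↦ digit c j == i

/-- Summation over the codes of all permutations. -/
def codeSum (g : ℕ → ℕ) : ℕ := (codes.map g).sum

theorem digit_code (p : Perm (Fin 4)) (i : Fin 4) : digit (code p) i = p i := by
  fin_cases i <;> simp [digit, code] <;> omega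

theorem code_injective : Function.Injective code := fun p q h ↦
  Equiv.ext fun i ↦ Fin.ext (by rw [← digit_code, ← digit_code, h])

theorem code_mul (p q : Perm (Fin 4)) : code (p * q) = codeMul (code p) (code q) := by
  have h0 := digit_code q 0
  have h1 := digit_code q 1
  have h2 := digit_code q 2
  have h3 := digit_code q 3
  simp only [Fin.coe_ofNat_eq_mod, Nat.reduceMod] at h0 h1 h2 h3
  simp only [codeMul, h0, h1, h2, h3, digit_code]
  rfl

theorem code_inv (p : Perm (Fin 4)) : code p⁻¹ = codeInv (code p) := by
  revert p
  decide +kernel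

theorem code_beq (p q : Perm (Fin 4)) : (code p == code q) = true ↔ p = q := by
  rw [beq_iff_eq, code_injective.eq_iff]

theorem sum_code (g : ℕ → ℕ) : ∑ p : Perm (Fin 4), g (code p) = codeSum g := by
  have h : (Finset.univ : Finset (Perm (Fin 4))).val.map code = (codes : Multiset ℕ) := by
    decide +kernel
  rw [Finset.sum_eq_multiset_sum, codeSum, ← Multiset.sum_coe, ← Multiset.map_coe, ← h,
    Multiset.map_map]
  rfl

/-! ### The conditions on the images of the generators -/

/-- Encoded test for being a transposition. -/
def swapTest (s : ℕ) : Bool :=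
  [0, 1, 2, 3].any fun i ↦ [0, 1, 2, 3].any fun j ↦ [0, 1, 2, 3].all fun k ↦
    i != j && digit s k == if k = i then j else if k = j then i else k

/-- Encoded relation (R2). -/
def r2Test (s x : ℕ) : Bool :=
  codeMul (codeMul (codeMul (codeInv s) x) (codeInv s)) x ==
    codeMul (codeMul (codeMul x (codeInv s)) x) (codeInv s)

/-- Encoded relation (R3). -/
def r3Test (s x y : ℕ) : Bool :=
  codeMul (codeMul (codeMul (codeInv s) x) s) y == codeMul (codeMul (codeMul y (codeInv s)) x) s

/-- Encoded relation (R4). -/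
def r4Test (s x y : ℕ) : Bool :=
  codeMul (codeMul (codeMul (codeInv s) x) (codeInv s)) y ==
    codeMul (codeMul (codeMul y (codeInv s)) x) s

/-- Encoded relation (TR). -/
def trTest (s a b c d : ℕ) : Bool :=
  codeMul (codeMul (codeMul (codeMul a (codeInv b)) (codeInv a)) b)
    (codeMul (codeMul (codeMul c (codeInv d)) (codeInv c)) d) == codeMul s s

/-- Whether the subset of `Fin 4` given by the bits of `m` is invariant under an encoded
permutation. -/
def invariantTest (m c : ℕ) : Bool :=
  [0, 1, 2, 3].all fun i ↦ m.testBit (digit c i) == m.testBit i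

/-- Encoded transitivity: no proper nonempty subset of `Fin 4` is invariant. -/
def transTest (s a b c d : ℕ) : Bool :=
  (List.range' 1 14).all fun m ↦ !(invariantTest m s && (invariantTest m a && (invariantTest m b &&
    (invariantTest m c && invariantTest m d))))

/-- The conditions on the image of `a₁`. -/
abbrev test₂ (s a : ℕ) : Bool := r2Test s a

/-- The conditions on the image of `b₁`. -/
def test₃ (s a b : ℕ) : Bool := r2Test s b && r4Test s a b

/-- The conditions on the image of `a₂`. -/
def test₄ (s a b c : ℕ) : Bool := r2Test s c && (r3Test s a c && r3Test s b c)

/-- The conditions on the image of `b₂`. -/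
def test₅ (s a b c d : ℕ) : Bool :=
  r2Test s d && (r4Test s c d && (r3Test s a d && (r3Test s b d &&
    (trTest s a b c d && transTest s a b c d))))

theorem swapTest_code (s : Perm (Fin 4)) : swapTest (code s) = true ↔ s.IsSwap := by
  revert s
  unfold Equiv.Perm.IsSwap
  decide +kernel

theorem r2Test_code (s x : Perm (Fin 4)) :
    r2Test (code s) (code x) = true ↔ s⁻¹ * x * s⁻¹ * x = x * s⁻¹ * x * s⁻¹ := by
  simp only [r2Test, ← code_mul, ← code_inv, code_beq]

theorem r3Test_code (s x y : Perm (Fin 4)) :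
    r3Test (code s) (code x) (code y) = true ↔ s⁻¹ * x * s * y = y * s⁻¹ * x * s := by
  simp only [r3Test, ← code_mul, ← code_inv, code_beq]

theorem r4Test_code (s x y : Perm (Fin 4)) :
    r4Test (code s) (code x) (code y) = true ↔ s⁻¹ * x * s⁻¹ * y = y * s⁻¹ * x * s := by
  simp only [r4Test, ← code_mul, ← code_inv, code_beq]

theorem trTest_code (s a b c d : Perm (Fin 4)) :
    trTest (code s) (code a) (code b) (code c) (code d) = true ↔
      (a * b⁻¹ * a⁻¹ * b) * (c * d⁻¹ * c⁻¹ * d) = s * s := by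
  simp only [trTest, ← code_mul, ← code_inv, code_beq]

theorem invariantTest_code (m : ℕ) (p : Perm (Fin 4)) :
    invariantTest m (code p) = true ↔ ∀ i : Fin 4, m.testBit (p i) = m.testBit i := by
  simp only [invariantTest, List.all_eq_true, beq_iff_eq]
  simp only [← digit_code]
  constructor
  · intro h i
    exact h i (by fin_cases i <;> simp)
  · intro h i hi
    have : i < 4 := by simp at hi; omega
    exact h ⟨i, this⟩

theorem exists_testBit_eq (f : Fin 4 → Bool) (h₁ : ∃ i, f i = true) (h₀ : ∃ i, f i = false) :
    ∃ m ∈ List.range' 1 14, ∀ i : Fin 4, m.testBit i = f i := by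
  revert f
  decide +kernel

theorem exists_testBit_of_mem :
    ∀ m ∈ List.range' 1 14,
      ∃ i j : Fin 4, m.testBit i = true ∧ m.testBit j = false := by
  decide +kernel

/-! ### Homomorphisms from `B` as tuples of permutations -/

/-- The images of `σ, a₁, b₁, a₂, b₂` under a homomorphism. -/
def images {G : Type*} [Group G] (φ : B →* G) : G × G × G × G × G :=
  (φ σB, φ (PresentedGroup.of Gen.a1), φ (PresentedGroup.of Gen.b1),
    φ (PresentedGroup.of Gen.a2), φ (PresentedGroup.of Gen.b2))

theorem images_injective {G : Type*} [Group G] :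
    Function.Injective (images : (B →* G) → G × G × G × G × G) := by
  intro φ ψ h
  simp only [images, Prod.mk.injEq] at h
  obtain ⟨hs, ha, hb, hc, hd⟩ := h
  refine PresentedGroup.ext fun x ↦ ?_
  cases x <;> assumption

/-- The map on generators with prescribed values. -/
def genMap {G : Type*} (s a b c d : G) : Gen → G
  | Gen.a1 => a
  | Gen.a2 => c
  | Gen.b1 => b
  | Gen.b2 => d
  | Gen.s => s

/-- The relations of `B`, imposed on elements of a group. -/
def Relations {G : Type*} [Group G] (s a b c d : G) : Prop :=
  s⁻¹ * a * s⁻¹ * a = a * s⁻¹ * a * s⁻¹ ∧ s⁻¹ * c * s⁻¹ * c = c * s⁻¹ * c * s⁻¹ ∧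
  s⁻¹ * b * s⁻¹ * b = b * s⁻¹ * b * s⁻¹ ∧ s⁻¹ * d * s⁻¹ * d = d * s⁻¹ * d * s⁻¹ ∧
  s⁻¹ * a * s * c = c * s⁻¹ * a * s ∧ s⁻¹ * b * s * d = d * s⁻¹ * b * s ∧
  s⁻¹ * a * s * d = d * s⁻¹ * a * s ∧ s⁻¹ * b * s * c = c * s⁻¹ * b * s ∧
  s⁻¹ * a * s⁻¹ * b = b * s⁻¹ * a * s ∧ s⁻¹ * c * s⁻¹ * d = d * s⁻¹ * c * s ∧
  (a * b⁻¹ * a⁻¹ * b) * (c * d⁻¹ * c⁻¹ * d) = s * s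

theorem relations_iff_lift {G : Type*} [Group G] (s a b c d : G) :
    Relations s a b c d ↔ ∀ r ∈ rels, FreeGroup.lift (genMap s a b c d) r = 1 := by
  simp only [rels, Set.mem_insert_iff, Set.mem_singleton_iff, forall_eq_or_imp, forall_eq,
    map_mul, map_inv, FreeGroup.lift_apply_of, genMap, mul_inv_eq_one, Relations]

theorem exists_images_eq {G : Type*} [Group G] {s a b c d : G} (h : Relations s a b c d) :
    ∃ φ : B →* G, images φ = (s, a, b, c, d) :=
  ⟨PresentedGroup.toGroup ((relations_iff_lift s a b c d).1 h),
    by simp [images, σB, genMap]⟩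

theorem relations_of_images_eq {G : Type*} [Group G] {φ : B →* G} {s a b c d : G}
    (h : images φ = (s, a, b, c, d)) : Relations s a b c d := by
  simp only [images, Prod.mk.injEq] at h
  obtain ⟨rfl, rfl, rfl, rfl, rfl⟩ := h
  rw [relations_iff_lift]
  intro r hr
  have hlift : FreeGroup.lift (genMap (φ σB) (φ (PresentedGroup.of Gen.a1))
      (φ (PresentedGroup.of Gen.b1)) (φ (PresentedGroup.of Gen.a2))
      (φ (PresentedGroup.of Gen.b2))) = φ.comp (PresentedGroup.mk rels) := by
    ext x
    cases x <;> simp [genMap] <;> rfl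
  rw [hlift, MonoidHom.comp_apply, PresentedGroup.one_of_mem hr, map_one]

theorem transitive_iff {φ : B →* Perm (Fin 4)} {s a b c d : Perm (Fin 4)}
    (h : images φ = (s, a, b, c, d)) :
    (∀ i j, ∃ g : B, φ g i = j) ↔
      transTest (code s) (code a) (code b) (code c) (code d) = true := by
  simp only [images, Prod.mk.injEq] at h
  obtain ⟨rfl, rfl, rfl, rfl, rfl⟩ := h
  simp only [transTest, List.all_eq_true, Bool.not_eq_true', Bool.eq_false_iff, ne_eq,
    Bool.and_eq_true, invariantTest_code]
  constructor
  · rintro ht m hm ⟨hs, ha, hb, hc, hd⟩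
    obtain ⟨i, j, hi, hj⟩ := exists_testBit_of_mem m hm
    obtain ⟨g, rfl⟩ := ht i j
    suffices key : ∀ k, m.testBit (φ g k) = m.testBit k by simp [key i, hi] at hj
    clear hj
    have hg : g ∈ Subgroup.closure (Set.range (PresentedGroup.of (rels := rels))) := by
      rw [PresentedGroup.closure_range_of]; trivial
    induction hg using Subgroup.closure_induction with
    | mem x hx => obtain ⟨y, rfl⟩ := hx; cases y <;> assumption
    | one => simp
    | mul x y _ _ hx hy => intro k; rw [map_mul, Equiv.Perm.mul_apply, hx, hy]
    | inv x _ hx => intro k; rw [← hx, ← Equiv.Perm.mul_apply, ← map_mul]; simp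
  · intro ht i j
    by_contra hij
    classical
    obtain ⟨m, hm, hbit⟩ := exists_testBit_eq (fun k ↦ decide (∃ g : B, φ g i = k))
      ⟨i, decide_eq_true ⟨1, by simp⟩⟩ ⟨j, decide_eq_false hij⟩
    have key (x : B) (k : Fin 4) : m.testBit (φ x k) = m.testBit k := by
      rw [hbit, hbit, decide_eq_decide]
      constructor
      · rintro ⟨g, hg⟩
        exact ⟨x⁻¹ * g, by rw [map_mul, Equiv.Perm.mul_apply, hg]; simp⟩
      · rintro ⟨g, rfl⟩
        exact ⟨x * g, by rw [map_mul, Equiv.Perm.mul_apply]⟩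
    exact ht m hm ⟨key _, key _, key _, key _, key _⟩

/-- The conditions for permutations to come from a generic monodromy representation. -/
def test (s a b c d : ℕ) : Bool :=
  swapTest s && (test₂ s a && (test₃ s a b && (test₄ s a b c && test₅ s a b c d)))

theorem image_isGeneric :
    Set.image images {φ : B →* Perm (Fin 4) | IsGeneric 4 φ} =
      ((Finset.univ.filter fun t : Perm (Fin 4) × Perm (Fin 4) × Perm (Fin 4) × Perm (Fin 4) ×
        Perm (Fin 4) ↦ test (code t.1) (code t.2.1) (code t.2.2.1) (code t.2.2.2.1)
          (code t.2.2.2.2) = true : Finset _) : Set _) := by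
  ext ⟨s, a, b, c, d⟩
  rw [Finset.mem_coe, Finset.mem_filter]
  simp only [Finset.mem_univ, true_and, Set.mem_ofPred_eq, Set.mem_image, test, test₃, test₄,
    test₅, Bool.and_eq_true, swapTest_code, r2Test_code, r3Test_code, r4Test_code, trTest_code]
  constructor
  · rintro ⟨φ, ⟨hs, ht⟩, hφ⟩
    have hr := relations_of_images_eq hφ
    rw [transitive_iff hφ] at ht
    have hs' : s.IsSwap := by rwa [← show φ σB = s from congrArg Prod.fst hφ]
    unfold Relations at hr
    tauto
  · intro h
    have hr : Relations s a b c d := by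
      unfold Relations
      tauto
    obtain ⟨φ, hφ⟩ := exists_images_eq hr
    refine ⟨φ, ⟨?_, (transitive_iff hφ).2 (by tauto)⟩, hφ⟩
    rw [show φ σB = s from congrArg Prod.fst hφ]
    exact h.1

/-- The number of encoded tuples passing `test`, organised to discard failures early. -/
def testCount : ℕ :=
  codeSum fun s ↦ bif swapTest s then
    codeSum fun a ↦ bif test₂ s a then
      codeSum fun b ↦ bif test₃ s a b then
        codeSum fun c ↦ bif test₄ s a b c then
          codeSum fun d ↦ (test₅ s a b c d).toNat
        else 0
      else 0
    else 0
  else 0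

theorem testCount_eq : testCount = 2880 := by
  decide +kernel

theorem ite_eq_toNat (x : Bool) : (if x = true then 1 else 0 : ℕ) = x.toNat := by
  cases x <;> rfl

theorem toNat_and (x y : Bool) : (x && y).toNat = bif x then y.toNat else 0 := by
  cases x <;> simp

theorem sum_bif {ι : Type*} [Fintype ι] (x : Bool) (f : ι → ℕ) :
    (∑ i, bif x then f i else 0) = bif x then ∑ i, f i else 0 := by
  cases x <;> simp

theorem card_test :
    (Finset.univ.filter fun t : Perm (Fin 4) × Perm (Fin 4) × Perm (Fin 4) × Perm (Fin 4) ×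
      Perm (Fin 4) ↦ test (code t.1) (code t.2.1) (code t.2.2.1) (code t.2.2.2.1)
        (code t.2.2.2.2) = true).card = testCount := by
  rw [Finset.card_filter]
  simp only [ite_eq_toNat, Fintype.sum_prod_type]
  simp only [test, toNat_and, sum_bif]
  simp only [testCount, ← sum_code]

end Braid

/-- There are exactly 2880 generic monodromy representations of B in S₄. -/
theorem stmt5 :
    Set.ncard {φ : B →* Equiv.Perm (Fin 4) | IsGeneric 4 φ} = 2880 := by
  rw [← Set.ncard_image_of_injective _ images_injective, image_isGeneric, Set.ncard_coe_finset,
    card_test, testCount_eq]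
end

section
/- For every generic monodromy representation φ of B in S₄, the image of φ is isomorphic to the dihedral group of order 8. -/
namespace Braid

open Equiv

/-- The dihedral group of order `8` acting on `Fin 4` as the symmetries of a square whose
diagonals are `{0, 1}` and `{2, 3}`. -/
def squareFun : DihedralGroup 4 → Perm (Fin 4)
  | .r i => (swap 0 2 * swap 2 1 * swap 1 3) ^ i.val
  | .sr i => swap 0 1 * (swap 0 2 * swap 2 1 * swap 1 3) ^ i.val

/-- `squareFun` as a group homomorphism. -/
def squareHom : DihedralGroup 4 →* Perm (Fin 4) where
  toFun := squareFun
  map_one' := by decide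
  map_mul' := by decide

theorem squareHom_injective : Function.Injective squareHom := by
  have h : ∀ x y, squareFun x = squareFun y → x = y := by decide
  exact fun x y => h x y

theorem mem_range_squareHom_of_commute {x : Perm (Fin 4)}
    (hx : x * (swap 0 1 * swap 2 3) = swap 0 1 * swap 2 3 * x) : x ∈ squareHom.range := by
  have h : ∀ x : Perm (Fin 4), x * (swap 0 1 * swap 2 3) = swap 0 1 * swap 2 3 * x →
      ∃ d, squareFun d = x := by decide
  exact h x hx

set_option maxRecDepth 10000 in
theorem mem_range_squareHom_or_fixes (x : Perm (Fin 4))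
    (hx : swap 0 1 * x * swap 0 1 * x = x * swap 0 1 * x * swap 0 1) :
    x ∈ squareHom.range ∨ ∃ k : Fin 4, swap 0 1 k = k ∧ x k = k ∧
      ∀ y : Perm (Fin 4), swap 0 1 * x * swap 0 1 * y = y * swap 0 1 * x * swap 0 1 → y k = k := by
  have h : ∀ x : Perm (Fin 4), swap 0 1 * x * swap 0 1 * x = x * swap 0 1 * x * swap 0 1 →
      x * (swap 0 1 * swap 2 3) = swap 0 1 * swap 2 3 * x ∨
      ∃ k : Fin 4, swap 0 1 k = k ∧ x k = k ∧
      ∀ y : Perm (Fin 4), swap 0 1 * x * swap 0 1 * y = y * swap 0 1 * x * swap 0 1 → y k = k := by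
    decide
  exact (h x hx).imp_left mem_range_squareHom_of_commute

/-- A subgroup of the square group that contains the diagonal reflection `(0 1)` and an element
moving `0` to `2` is the whole square group. -/
theorem range_squareHom_le {H : Subgroup (Perm (Fin 4))} (hs : swap 0 1 ∈ H)
    {g : Perm (Fin 4)} (hg : g ∈ H) (hgD : g ∈ squareHom.range) (h02 : g 0 = 2) :
    squareHom.range ≤ H := by
  have key : ∀ a : DihedralGroup 4, squareFun a 0 = 2 → ∀ b : DihedralGroup 4,
      ∃ i j k : Fin 2, squareFun b = swap 0 1 ^ i.val *
        (squareFun a * swap 0 1 * (squareFun a)⁻¹) ^ j.val * squareFun a ^ k.val := by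
    decide
  obtain ⟨a, rfl⟩ := hgD
  rintro _ ⟨b, rfl⟩
  obtain ⟨i, j, k, h⟩ := key a h02 b
  change squareFun b ∈ H
  rw [h]
  exact H.mul_mem (H.mul_mem (H.pow_mem hs _)
    (H.pow_mem (H.mul_mem (H.mul_mem hg hs) (H.inv_mem hg)) _)) (H.pow_mem hg _)

theorem range_le_of_generators {G : Type*} [Group G] (φ : B →* G) (K : Subgroup G)
    (h : ∀ g, φ (PresentedGroup.of g) ∈ K) : φ.range ≤ K := by
  rw [MonoidHom.range_eq_map, ← PresentedGroup.closure_range_of, Subgroup.map_le_iff_le_comap,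
    Subgroup.closure_le]
  rintro _ ⟨g, rfl⟩
  exact h g

theorem map_relation {G : Type*} [Group G] (φ : B →* G) {u v : FreeGroup Gen}
    (h : u * v⁻¹ ∈ rels) :
    φ (PresentedGroup.mk rels u) = φ (PresentedGroup.mk rels v) := by
  congr 1
  rw [← mul_inv_eq_one, ← map_inv, ← map_mul]
  exact PresentedGroup.one_of_mem h

/-- If `σ` acts as an involution, each other generator `x` satisfies `(σx)² = (xσ)²`. -/
theorem sigma_relation {G : Type*} [Group G] (φ : B →* G) (hs : (φ σB)⁻¹ = φ σB)
    {x : Gen} (hx : x ≠ .s) :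
    φ σB * φ (.of x) * φ σB * φ (.of x) = φ (.of x) * φ σB * φ (.of x) * φ σB := by
  have h := @map_relation G _ φ
    (Sg⁻¹ * .of x * Sg⁻¹ * .of x) (.of x * Sg⁻¹ * .of x * Sg⁻¹) (by
      cases x <;> simp_all [rels])
  simp only [map_mul, map_inv] at h
  change (φ σB)⁻¹ * φ (.of x) * (φ σB)⁻¹ * φ (.of x) =
    φ (.of x) * (φ σB)⁻¹ * φ (.of x) * (φ σB)⁻¹ at h
  rwa [hs] at h

/-- If `σ` acts as an involution, `σxσ` commutes with `y` for any two distinct generators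
`x` and `y` other than `σ`. -/
theorem sigma_conj_relation {G : Type*} [Group G] (φ : B →* G) (hs : (φ σB)⁻¹ = φ σB)
    {x y : Gen} (hx : x ≠ .s) (hy : y ≠ .s) (hxy : x ≠ y) :
    φ σB * φ (.of x) * φ σB * φ (.of y) = φ (.of y) * φ σB * φ (.of x) * φ σB := by
  have hsq : φ σB * φ σB = 1 := by nth_rewrite 1 [← hs]; exact inv_mul_cancel _
  have symm : ∀ {a b : G}, φ σB * a * φ σB * b = b * φ σB * a * φ σB →
      φ σB * b * φ σB * a = a * φ σB * b * φ σB := by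
    intro a b h
    have h1 := congrArg (fun t => φ σB * t * φ σB) h
    simp only [mul_assoc] at h1 ⊢
    simp only [hsq, mul_one] at h1
    simpa [← mul_assoc, hsq] using h1.symm
  have r3 : ∀ x y : Gen, Sg⁻¹ * .of x * Sg * .of y * (.of y * Sg⁻¹ * .of x * Sg)⁻¹ ∈ rels →
      φ σB * φ (.of x) * φ σB * φ (.of y) = φ (.of y) * φ σB * φ (.of x) * φ σB := by
    intro x y h
    have h := map_relation φ h
    simp only [map_mul, map_inv] at h
    change (φ σB)⁻¹ * φ (.of x) * φ σB * φ (.of y) =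
      φ (.of y) * (φ σB)⁻¹ * φ (.of x) * φ σB at h
    rwa [hs] at h
  have r4 : ∀ x y : Gen, Sg⁻¹ * .of x * Sg⁻¹ * .of y * (.of y * Sg⁻¹ * .of x * Sg)⁻¹ ∈ rels →
      φ σB * φ (.of x) * φ σB * φ (.of y) = φ (.of y) * φ σB * φ (.of x) * φ σB := by
    intro x y h
    have h := map_relation φ h
    simp only [map_mul, map_inv] at h
    change (φ σB)⁻¹ * φ (.of x) * (φ σB)⁻¹ * φ (.of y) =
      φ (.of y) * (φ σB)⁻¹ * φ (.of x) * φ σB at h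
    rwa [hs] at h
  have a1a2 := r3 .a1 .a2 (by simp [rels])
  have b1b2 := r3 .b1 .b2 (by simp [rels])
  have a1b2 := r3 .a1 .b2 (by simp [rels])
  have b1a2 := r3 .b1 .a2 (by simp [rels])
  have a1b1 := r4 .a1 .b1 (by simp [rels])
  have a2b2 := r4 .a2 .b2 (by simp [rels])
  cases x <;> cases y <;> first | contradiction | assumption | (apply symm; assumption)

theorem range_eq_range_squareHom {φ : B →* Perm (Fin 4)} (hs : φ σB = swap 0 1)
    (htrans : ∀ i j : Fin 4, ∃ g : B, φ g i = j) : φ.range = squareHom.range := by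
  have hinv : (φ σB)⁻¹ = φ σB := by rw [hs, swap_inv]
  have hgen : ∀ x, φ (.of x) ∈ squareHom.range := by
    intro x
    by_cases hx : x = .s
    · subst hx
      exact ⟨.sr 0, hs.symm⟩
    have h := sigma_relation φ hinv hx
    rw [hs] at h
    refine (mem_range_squareHom_or_fixes _ h).resolve_right ?_
    rintro ⟨k, hsk, hxk, hk⟩
    have hstab : φ.range ≤ MulAction.stabilizer (Perm (Fin 4)) k := by
      refine range_le_of_generators φ _ fun y => ?_
      rw [MulAction.mem_stabilizer_iff, Perm.smul_def]
      by_cases hys : y = .s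
      · subst hys
        exact (congrArg (· k) hs).trans hsk
      by_cases hxy : x = y
      · exact hxy ▸ hxk
      have h := sigma_conj_relation φ hinv hx hys hxy
      rw [hs] at h
      exact hk _ h
    obtain ⟨g, hg⟩ := htrans k (k + 1)
    have h := hstab ⟨g, rfl⟩
    rw [MulAction.mem_stabilizer_iff, Perm.smul_def, hg] at h
    simp at h
  have hle := range_le_of_generators φ _ hgen
  obtain ⟨g, hg⟩ := htrans 0 2
  exact hle.antisymm (range_squareHom_le ⟨σB, hs⟩ ⟨g, rfl⟩ (hle ⟨g, rfl⟩) hg)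

end Braid

open Braid

/-- For every generic monodromy representation φ of B in S₄, the image of φ
is isomorphic to the dihedral group of order 8. -/
theorem stmt6 (φ : B →* Equiv.Perm (Fin 4)) (h : IsGeneric 4 φ) :
    Nonempty (φ.range ≃* DihedralGroup 4) := by
  obtain ⟨⟨i, j, hij, hs⟩, htrans⟩ := h
  obtain ⟨c, hc⟩ := isConj_iff.1
    (Equiv.Perm.isConj_swap hij (show (0 : Fin 4) ≠ 1 by decide))
  let τ := MulAut.conj c
  have hrange : (τ.toMonoidHom.comp φ).range = squareHom.range := by
    refine range_eq_range_squareHom ?_ fun i j => ?_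
    · change c * φ σB * c⁻¹ = _
      rw [hs, hc]
    · obtain ⟨g, hg⟩ := htrans (c⁻¹ i) (c⁻¹ j)
      refine ⟨g, ?_⟩
      change c (φ g (c⁻¹ i)) = j
      exact (congrArg c hg).trans (c.apply_symm_apply j)
  rw [MonoidHom.range_comp] at hrange
  exact ⟨(φ.range.equivMapOfInjective τ.toMonoidHom τ.injective).trans
    ((MulEquiv.subgroupCongr hrange).trans
      (MonoidHom.ofInjective squareHom_injective).symm)⟩
end

section
/- The conjugation action of S₄ on the set of generic monodromy representations of B in S₄ has exactly 240 orbits. -/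
open Braid

namespace Braid

open Equiv

/-- The transposition `(0 1)`. -/
abbrev s01 : Perm (Fin 4) := swap 0 1

/-- The central involution `(0 1)(2 3)` of the dihedral group containing `(0 1)`. -/
abbrev z4 : Perm (Fin 4) := swap 0 1 * swap 2 3

/-- `(0 2)(1 3)` for `k = false`, and the 4-cycle `(0 2 1 3)` for `k = true`. -/
def blockSwap (k : Bool) : Perm (Fin 4) :=
  if k then swap 0 1 * (swap 0 2 * swap 1 3) else swap 0 2 * swap 1 3

/-- The elements of the two abelian subgroups of order four of the centralizer of `z4`
that act transitively. -/
def dihElt (k p q : Bool) : Perm (Fin 4) :=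
  (if p then blockSwap k else 1) * (if q then z4 else 1)

/-- The four generators other than `σ`. -/
def surfGen : Fin 4 → Gen := ![Gen.a1, Gen.b1, Gen.a2, Gen.b2]

/-- The assignment sending `σ` to `(0 1)` and the other generators to a given tuple. -/
def assign (x : Fin 4 → Perm (Fin 4)) : Gen → Perm (Fin 4)
  | Gen.a1 => x 0
  | Gen.b1 => x 1
  | Gen.a2 => x 2
  | Gen.b2 => x 3
  | Gen.s => s01

/-- Normal forms for tuples of commuting elements which are not all central:
the first noncentral entry is normalized by conjugation with `(0 1)`. -/
abbrev NormalForm : Type :=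
  {t : Bool × (Fin 4 → Bool) × (Fin 4 → Bool) //
    ∃ i, t.2.1 i = true ∧ t.2.2 i = false ∧ ∀ j < i, t.2.1 j = false}

/-- The tuple of permutations attached to a normal form. -/
def tuple (t : Bool × (Fin 4 → Bool) × (Fin 4 → Bool)) (i : Fin 4) : Perm (Fin 4) :=
  dihElt t.1 (t.2.1 i) (t.2.2 i)

lemma card_normalForm : Nat.card NormalForm = 240 := by
  rw [Nat.card_eq_fintype_card]
  decide +kernel

lemma dihElt_comm (k p q p' q' : Bool) :
    dihElt k p q * dihElt k p' q' = dihElt k p' q' * dihElt k p q := by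
  revert k p q p' q'; decide +kernel

lemma dihElt_twisted_comm (k p q p' q' : Bool) :
    s01 * dihElt k p q * s01 * dihElt k p' q' = dihElt k p' q' * s01 * dihElt k p q * s01 := by
  revert k p q p' q'; decide +kernel

lemma conj_dihElt (k p q : Bool) :
    s01 * dihElt k p q * s01⁻¹ = dihElt k p (xor q p) := by
  revert k p q; decide +kernel

lemma dihElt_transitive (k q : Bool) (i j : Fin 4) :
    ∃ a b c d : Bool, (s01 ^ a.toNat * dihElt k true q ^ b.toNat * s01 ^ c.toNat *
      dihElt k true q ^ d.toNat) i = j := by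
  revert k q i j; decide +kernel

lemma dihElt_injective {k p q k' p' q' : Bool} (h : dihElt k p q = dihElt k' p' q') :
    p = p' ∧ q = q' ∧ (p = true → k = k') := by
  revert k p q k' p' q'; decide +kernel

lemma conj_eq_of_commute {τ : Perm (Fin 4)} (h : τ * s01 * τ⁻¹ = s01) :
    (∀ k p q, τ * dihElt k p q * τ⁻¹ = dihElt k p q) ∨
    (∀ k p q, τ * dihElt k p q * τ⁻¹ = dihElt k p (xor q p)) := by
  revert τ; decide +kernel

lemma exists_fixed_of_not_commute {x : Perm (Fin 4)}
    (h : s01 * x * s01 * x = x * s01 * x * s01) (hz : x * z4 ≠ z4 * x) :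
    ∃ m, s01 m = m ∧ ∀ y, s01 * x * s01 * y = y * s01 * x * s01 → y m = m := by
  revert x; decide +kernel

lemma commute_of_twisted {x y : Perm (Fin 4)} (hx : x * z4 = z4 * x) (hy : y * z4 = z4 * y)
    (h : s01 * x * s01 * y = y * s01 * x * s01) : x * y = y * x := by
  revert x y; decide +kernel

lemma eq_dihElt_or_preserves {x : Perm (Fin 4)} (hx : x * z4 = z4 * x) :
    (∃ k q, x = dihElt k true q) ∨ ∀ m, (x m < 2 ↔ m < 2) := by
  revert x; decide +kernel

lemma eq_dihElt_of_commute {k q : Bool} {x : Perm (Fin 4)}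
    (h : dihElt k true q * x = x * dihElt k true q) (hx : x * z4 = z4 * x) :
    ∃ p q', x = dihElt k p q' := by
  revert k q x; decide +kernel

lemma rels_of_tuple (t : Bool × (Fin 4 → Bool) × (Fin 4 → Bool)) :
    ∀ r ∈ rels, FreeGroup.lift (assign (tuple t)) r = 1 := by
  have hc : ∀ i j, tuple t i * tuple t j = tuple t j * tuple t i :=
    fun i j => dihElt_comm _ _ _ _ _
  have ht : ∀ i j, s01 * tuple t i * s01 * tuple t j = tuple t j * s01 * tuple t i * s01 :=
    fun i j => dihElt_twisted_comm _ _ _ _ _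
  have hci : ∀ i j, tuple t i * (tuple t j)⁻¹ * (tuple t i)⁻¹ * tuple t j = 1 := fun i j => by
    have := (show Commute (tuple t i) (tuple t j) from hc i j).inv_right.eq
    rw [this]; group
  have hs : s01⁻¹ = s01 := swap_inv 0 1
  have hss : s01 * s01 = 1 := swap_mul_self 0 1
  intro r hr
  simp only [rels, Set.mem_insert_iff, Set.mem_singleton_iff] at hr
  rcases hr with h | h | h | h | h | h | h | h | h | h | h <;> subst h <;>
    simp only [map_mul, map_inv, FreeGroup.lift_apply_of, assign, hs, hci, hss, one_mul, inv_one,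
      mul_inv_eq_one] <;> exact ht _ _

/-- The representation attached to a normal form. -/
def rep (t : Bool × (Fin 4 → Bool) × (Fin 4 → Bool)) : B →* Perm (Fin 4) :=
  PresentedGroup.toGroup (rels_of_tuple t)

lemma rep_of (t : Bool × (Fin 4 → Bool) × (Fin 4 → Bool)) (g : Gen) :
    rep t (PresentedGroup.of g) = assign (tuple t) g :=
  PresentedGroup.toGroup.of _

lemma assign_surfGen (x : Fin 4 → Perm (Fin 4)) (i : Fin 4) : assign x (surfGen i) = x i := by
  fin_cases i <;> rfl

lemma rep_surfGen (t : Bool × (Fin 4 → Bool) × (Fin 4 → Bool)) (i : Fin 4) :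
    rep t (PresentedGroup.of (surfGen i)) = dihElt t.1 (t.2.1 i) (t.2.2 i) := by
  rw [rep_of, assign_surfGen, tuple]

lemma forall_gen {P : Gen → Prop} (h : ∀ i, P (surfGen i)) (hs : P Gen.s) : ∀ g, P g := by
  rintro (_ | _ | _ | _ | _)
  exacts [h 0, h 2, h 1, h 3, hs]

lemma isGeneric_rep (t : NormalForm) : IsGeneric 4 (rep t.1) := by
  obtain ⟨t, i, hp, -⟩ := t
  have hs : rep t σB = s01 := rep_of t Gen.s
  refine ⟨⟨0, 1, by decide, hs⟩, fun m n => ?_⟩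
  obtain ⟨a, b, c, d, h⟩ := dihElt_transitive t.1 (t.2.2 i) m n
  have hx := rep_surfGen t i
  rw [hp] at hx
  refine ⟨σB ^ a.toNat * PresentedGroup.of (surfGen i) ^ b.toNat * σB ^ c.toNat *
      PresentedGroup.of (surfGen i) ^ d.toNat, ?_⟩
  simpa only [map_mul, map_pow, hs, hx] using h

lemma preserves_of_gen (φ : B →* Perm (Fin 4)) (P : Fin 4 → Prop)
    (h : ∀ g : Gen, ∀ m, P (φ (PresentedGroup.of g) m) ↔ P m) (g : B) (m : Fin 4) :
    P (φ g m) ↔ P m := by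
  have hg : g ∈ Subgroup.closure (Set.range (PresentedGroup.of (rels := rels))) := by
    rw [PresentedGroup.closure_range_of]; trivial
  induction hg using Subgroup.closure_induction generalizing m with
  | mem x hx => obtain ⟨y, rfl⟩ := hx; exact h y m
  | one => simp
  | mul x y _ _ hx hy => rw [map_mul, Perm.mul_apply]; exact (hx _).trans (hy _)
  | inv x _ hx => exact (hx _).symm.trans (by rw [map_inv, ← Perm.mul_apply, mul_inv_cancel, Perm.one_apply])

lemma map_rel (φ : B →* Perm (Fin 4)) {r : FreeGroup Gen} (hr : r ∈ rels) :
    FreeGroup.lift (fun g => φ (PresentedGroup.of g)) r = 1 := by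
  have : FreeGroup.lift (fun g => φ (PresentedGroup.of g)) = φ.comp (PresentedGroup.mk rels) := by
    ext1 g
    simp [PresentedGroup.of]
  rw [this, MonoidHom.comp_apply, PresentedGroup.one_of_mem hr, map_one]

lemma twisted_comm_of_rels {f : Gen → Perm (Fin 4)} (hr : ∀ r ∈ rels, FreeGroup.lift f r = 1)
    (hs : f Gen.s = s01) (i j : Fin 4) :
    s01 * f (surfGen i) * s01 * f (surfGen j) = f (surfGen j) * s01 * f (surfGen i) * s01 := by
  have hsi : s01⁻¹ = s01 := swap_inv 0 1
  have hss : s01 * s01 = 1 := swap_mul_self 0 1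
  simp only [rels, Set.mem_insert_iff, Set.mem_singleton_iff, forall_eq_or_imp, forall_eq,
    map_mul, map_inv, FreeGroup.lift_apply_of, hs, hsi, mul_inv_eq_one] at hr
  obtain ⟨h1, h2, h3, h4, h5, h6, h7, h8, h9, h10, -⟩ := hr
  have symm : ∀ x y : Perm (Fin 4), s01 * x * s01 * y = y * s01 * x * s01 →
      s01 * y * s01 * x = x * s01 * y * s01 := by
    intro x y h
    calc s01 * y * s01 * x = s01 * (y * s01 * x * s01) * s01 := by
          simp only [mul_assoc, hss, mul_one]
      _ = s01 * (s01 * x * s01 * y) * s01 := by rw [h]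
      _ = (s01 * s01) * x * s01 * y * s01 := by simp only [mul_assoc]
      _ = x * s01 * y * s01 := by rw [hss, one_mul]
  fin_cases i <;> fin_cases j <;>
    first
      | assumption
      | (apply symm; assumption)

lemma exists_normalForm (φ : B →* Perm (Fin 4)) (hs : φ σB = s01)
    (ht : ∀ i j : Fin 4, ∃ g : B, φ g i = j) :
    ∃ t : NormalForm, ∃ τ : Perm (Fin 4), ∀ g, φ g = τ * rep t.1 g * τ⁻¹ := by
  have hrel := twisted_comm_of_rels (fun r => map_rel φ) hs
  set x : Fin 4 → Perm (Fin 4) := fun i => φ (PresentedGroup.of (surfGen i))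
  have hz : ∀ i, x i * z4 = z4 * x i := by
    intro i
    by_contra hi
    obtain ⟨m, hm, hy⟩ := exists_fixed_of_not_commute (hrel i i) hi
    have fixed : ∀ g : Gen, φ (PresentedGroup.of g) m = m :=
      forall_gen (fun j => hy _ (hrel i j)) ((congrArg (· m) hs).trans hm)
    have key := preserves_of_gen φ (· = m) fun g n =>
      ⟨fun h => (φ (PresentedGroup.of g)).injective (h.trans (fixed g).symm),
        fun h => by rw [h]; exact fixed g⟩
    obtain ⟨g, hg⟩ := ht m (m + 1)
    have := (key g m).2 rfl
    rw [hg] at this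
    exact absurd this (by clear * -; revert m; decide)
  obtain ⟨i₀, k, q₀, hi₀⟩ : ∃ i k q, x i = dihElt k true q := by
    by_contra! hne
    have key := preserves_of_gen φ (· < 2) (forall_gen
      (fun i => (eq_dihElt_or_preserves (hz i)).resolve_left
        (fun ⟨k, q, h⟩ => hne i k q h))
      (by
        have hs' : φ (PresentedGroup.of Gen.s) = s01 := hs
        rw [hs']; decide))
    obtain ⟨g, hg⟩ := ht 0 2
    have := (key g 0).2 (by decide)
    rw [hg] at this
    exact absurd this (by decide)
  have hd : ∀ i, ∃ p q, x i = dihElt k p q := fun i => by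
    refine eq_dihElt_of_commute (q := q₀) ?_ (hz i)
    rw [← hi₀]
    exact commute_of_twisted (hz i₀) (hz i) (hrel i₀ i)
  choose p q hpq using hd
  have hp₀ : p i₀ = true := (dihElt_injective ((hpq i₀).symm.trans hi₀)).1
  obtain ⟨i, hi, hmin⟩ : ∃ i, p i = true ∧ ∀ j < i, p j = false := by
    obtain ⟨i, hi, hmin⟩ := WellFounded.has_min (wellFounded_lt (α := Fin 4))
      {i | p i = true} ⟨i₀, hp₀⟩
    exact ⟨i, hi, fun j hj => by simpa using fun h => hmin j h hj⟩
  have ext_conj : ∀ (t : NormalForm) (τ : Perm (Fin 4)), τ * s01 * τ⁻¹ = s01 →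
      (∀ j, x j = τ * tuple t.1 j * τ⁻¹) → ∀ g, φ g = τ * rep t.1 g * τ⁻¹ := by
    intro t τ hτ h g
    have : φ = (MulAut.conj τ).toMonoidHom.comp (rep t.1) := by
      apply PresentedGroup.ext
      refine forall_gen (fun j => ?_) ?_
      · simpa [rep_of, assign_surfGen] using h j
      · exact hs.trans (hτ.symm.trans (by simp [rep_of, assign]))
    rw [this]; rfl
  cases hq : q i with
  | false =>
    refine ⟨⟨(k, p, q), i, hi, hq, hmin⟩, 1, ext_conj _ _ (by simp) fun j => ?_⟩
    simp [hpq, tuple]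
  | true =>
    refine ⟨⟨(k, p, fun j => xor (q j) (p j)), i, hi, by simp [hq, hi], hmin⟩, s01,
      ext_conj _ _ (by simp) fun j => ?_⟩
    rw [tuple, conj_dihElt, hpq]
    simp

lemma normalForm_unique (t u : NormalForm) (τ : Perm (Fin 4))
    (h : ∀ g, rep u.1 g = τ * rep t.1 g * τ⁻¹) : t = u := by
  have hτ : τ * s01 * τ⁻¹ = s01 := by
    have := h (PresentedGroup.of Gen.s)
    rw [rep_of, rep_of] at this
    exact this.symm
  have hg : ∀ i, _ := fun i => h (PresentedGroup.of (surfGen i))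
  simp only [rep_surfGen] at hg
  obtain ⟨⟨k, p, q⟩, i, hi, hqi, hmin⟩ := t
  obtain ⟨⟨k', p', q'⟩, i', hi', hqi', hmin'⟩ := u
  change p i = true at hi
  change p' i' = true at hi'
  change q i = false at hqi
  change q' i' = false at hqi'
  change ∀ j < i, p j = false at hmin
  change ∀ j < i', p' j = false at hmin'
  dsimp only at hg
  have finish : (∀ j, dihElt k' (p' j) (q' j) = dihElt k (p j) (q j)) →
      k = k' ∧ p = p' ∧ q = q' := fun H =>
    ⟨((dihElt_injective (H i')).2.2 hi').symm, funext fun j => (dihElt_injective (H j)).1.symm,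
      funext fun j => (dihElt_injective (H j)).2.1.symm⟩
  rcases conj_eq_of_commute hτ with hc | hc
  · simp only [hc] at hg
    obtain ⟨rfl, rfl, rfl⟩ := finish hg
    rfl
  · simp only [hc] at hg
    have hp : p' = p := funext fun j => (dihElt_injective (hg j)).1
    subst hp
    have hii : i = i' := by
      rcases lt_trichotomy i i' with hlt | heq | hlt
      · simp [hmin' i hlt] at hi
      · exact heq
      · simp [hmin i' hlt] at hi'
    subst hii
    have := (dihElt_injective (hg i)).2.1
    simp [hqi, hqi', hi] at this

lemma exists_conj_s01 {π : Perm (Fin 4)} (h : π.IsSwap) :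
    ∃ ρ : Perm (Fin 4), ρ * π * ρ⁻¹ = s01 :=
  isConj_iff.1 (Perm.isConj_iff_cycleType_eq.2
    ((Perm.isSwap_iff_cycleType.1 h).trans
      (Perm.isSwap_iff_cycleType.1 ⟨0, 1, by decide, rfl⟩).symm))

end Braid

/-- The conjugation action of S₄ on the set of generic monodromy
representations of B in S₄ has exactly 240 orbits. -/
theorem stmt7 :
    Nat.card (Quot (fun (φ ψ : {φ : B →* Equiv.Perm (Fin 4) // IsGeneric 4 φ}) =>
      ∃ τ : Equiv.Perm (Fin 4), ∀ g : B, ψ.1 g = τ * φ.1 g * τ⁻¹)) = 240 := by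
  set r := fun (φ ψ : {φ : B →* Equiv.Perm (Fin 4) // IsGeneric 4 φ}) =>
      ∃ τ : Equiv.Perm (Fin 4), ∀ g : B, ψ.1 g = τ * φ.1 g * τ⁻¹
  have heq : Equivalence r :=
    { refl := fun φ => ⟨1, by simp⟩
      symm := fun ⟨τ, h⟩ => ⟨τ⁻¹, fun g => by rw [h]; group⟩
      trans := fun ⟨τ, h⟩ ⟨τ', h'⟩ => ⟨τ' * τ, fun g => by rw [h', h]; group⟩ }
  rw [← card_normalForm]
  refine (Nat.card_congr (Equiv.ofBijective
    (fun t : NormalForm => Quot.mk r ⟨rep t.1, isGeneric_rep t⟩) ⟨fun t u h => ?_, ?_⟩)).symm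
  · obtain ⟨τ, hτ⟩ := heq.eqvGen_iff.1 (Quot.eqvGen_exact h)
    exact normalForm_unique t u τ hτ
  · rintro ⟨φ, hσ, ht⟩
    obtain ⟨ρ, hρ⟩ := exists_conj_s01 hσ
    obtain ⟨t, τ, h⟩ := exists_normalForm ((MulAut.conj ρ).toMonoidHom.comp φ) hρ fun i j => by
      obtain ⟨g, hg⟩ := ht (ρ⁻¹ i) (ρ⁻¹ j)
      refine ⟨g, ?_⟩
      change ρ (φ g (ρ⁻¹ i)) = j
      rw [hg, ← Equiv.Perm.mul_apply, mul_inv_cancel, Equiv.Perm.one_apply]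
    refine ⟨t, Quot.sound ⟨ρ⁻¹ * τ, fun g => ?_⟩⟩
    have := h g
    simp only [MonoidHom.comp_apply, MulEquiv.coe_toMonoidHom, MulAut.conj_apply] at this
    calc φ g = ρ⁻¹ * (ρ * φ g * ρ⁻¹) * ρ := by group
      _ = _ := by rw [this]; group
end

section
/- There are exactly 43200 (= 15 · 2880) generic monodromy representations of B in S₆, i.e. the set of group homomorphisms φ: B → S₆ such that φ(σ) is a transposition and the image of φ is a transitive subgroup of S₆ has cardinality 43200. -/
open Braid

namespace Braid

open Equiv

instance : Fintype Gen where
  elems := {Gen.a1, Gen.a2, Gen.b1, Gen.b2, Gen.s}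
  complete := by rintro ⟨⟩ <;> decide

/-! ### Homomorphisms out of `B` -/

section Presentation

variable {G : Type*} [Group G]

lemma hom_ext {φ ψ : B →* G}
    (h : (fun x => φ (PresentedGroup.of x)) = fun x => ψ (PresentedGroup.of x)) : φ = ψ :=
  PresentedGroup.ext fun x => congrFun h x

lemma lift_eq_one (φ : B →* G) {r : FreeGroup Gen} (hr : r ∈ rels) :
    FreeGroup.lift (fun x => φ (PresentedGroup.of x)) r = 1 := by
  have h : FreeGroup.lift (fun x => φ (PresentedGroup.of x)) =
      φ.comp (PresentedGroup.mk rels) := by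
    ext x
    simp [PresentedGroup.of]
  rw [h, MonoidHom.comp_apply, PresentedGroup.one_of_mem hr, map_one]

lemma commute_conj_symm {s x y : G} (hs : s * s = 1) (h : Commute (s * x * s) y) :
    Commute (s * y * s) x := by
  have hs' : s⁻¹ = s := inv_eq_of_mul_eq_one_left hs
  have := h.symm.conj s
  rw [hs'] at this
  simpa [mul_assoc, hs, ← mul_assoc s s] using this

/-- When `σ` is sent to an involution `s`, the braid relations say that the images of the other
generators commute with all their conjugates by `s`. -/
lemma lift_rels_iff {f : Gen → G} (hs : f .s * f .s = 1) :
    (∀ r ∈ rels, FreeGroup.lift f r = 1) ↔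
      (∀ x ≠ Gen.s, ∀ y ≠ Gen.s, Commute (f .s * f x * f .s) (f y)) ∧
      (f .a1 * (f .b1)⁻¹ * (f .a1)⁻¹ * f .b1) * (f .a2 * (f .b2)⁻¹ * (f .a2)⁻¹ * f .b2) = 1 := by
  have hs' : (f .s)⁻¹ = f .s := inv_eq_of_mul_eq_one_left hs
  simp only [rels, Set.mem_insert_iff, Set.mem_singleton_iff, forall_eq_or_imp, forall_eq,
    map_mul, map_inv, FreeGroup.lift_apply_of, hs, hs', mul_inv_eq_one, inv_one, mul_one]
  constructor
  · rintro ⟨h1, h2, h3, h4, h5, h6, h7, h8, h9, h10, h11⟩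
    refine ⟨?_, h11⟩
    simp only [mul_assoc] at h1 h2 h3 h4 h5 h6 h7 h8 h9 h10
    have c5 : Commute (f .s * f .a1 * f .s) (f .a2) := by simpa [Commute, SemiconjBy, mul_assoc]
    have c6 : Commute (f .s * f .b1 * f .s) (f .b2) := by simpa [Commute, SemiconjBy, mul_assoc]
    have c7 : Commute (f .s * f .a1 * f .s) (f .b2) := by simpa [Commute, SemiconjBy, mul_assoc]
    have c8 : Commute (f .s * f .b1 * f .s) (f .a2) := by simpa [Commute, SemiconjBy, mul_assoc]
    have c9 : Commute (f .s * f .a1 * f .s) (f .b1) := by simpa [Commute, SemiconjBy, mul_assoc]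
    have c10 : Commute (f .s * f .a2 * f .s) (f .b2) := by simpa [Commute, SemiconjBy, mul_assoc]
    have := commute_conj_symm hs c5
    have := commute_conj_symm hs c6
    have := commute_conj_symm hs c7
    have := commute_conj_symm hs c8
    have := commute_conj_symm hs c9
    have := commute_conj_symm hs c10
    rintro (_ | _) hx (_ | _) hy <;> first
      | assumption
      | contradiction
      | simpa [Commute, SemiconjBy, mul_assoc]
  · rintro ⟨h, h11⟩
    refine ⟨?_, ?_, ?_, ?_, ?_, ?_, ?_, ?_, ?_, ?_, h11⟩ <;>
    first
      | simpa [Commute, SemiconjBy, mul_assoc] using h .a1 nofun .a1 nofun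
      | simpa [Commute, SemiconjBy, mul_assoc] using h .a2 nofun .a2 nofun
      | simpa [Commute, SemiconjBy, mul_assoc] using h .b1 nofun .b1 nofun
      | simpa [Commute, SemiconjBy, mul_assoc] using h .b2 nofun .b2 nofun
      | simpa [Commute, SemiconjBy, mul_assoc] using h .a1 nofun .a2 nofun
      | simpa [Commute, SemiconjBy, mul_assoc] using h .b1 nofun .b2 nofun
      | simpa [Commute, SemiconjBy, mul_assoc] using h .a1 nofun .b2 nofun
      | simpa [Commute, SemiconjBy, mul_assoc] using h .b1 nofun .a2 nofun
      | simpa [Commute, SemiconjBy, mul_assoc] using h .a1 nofun .b1 nofun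
      | simpa [Commute, SemiconjBy, mul_assoc] using h .a2 nofun .b2 nofun

end Presentation

/-! ### The regular model -/

/-- A labelling of the points of `Fin 6` by the elements of `D₃`: the two `3`-cycles are labelled
`0` and `1`, the identity `2`, and the transpositions `3`, `4`, `5`. -/
def label : DihedralGroup 3 ≃ Fin 6 where
  toFun
    | .r i => (![2, 0, 1] : Fin 3 → Fin 6) i
    | .sr i => (![3, 4, 5] : Fin 3 → Fin 6) i
  invFun := ![.r 1, .r 2, .r 0, .sr 0, .sr 1, .sr 2]
  left_inv := by decide +kernel
  right_inv := by decide +kernel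

/-- The left regular representation of `D₃`, read through `label`. -/
def leftReg : DihedralGroup 3 →* Perm (Fin 6) where
  toFun g := label.permCongr (Equiv.mulLeft g)
  map_one' := by ext; simp
  map_mul' g h := by ext; simp

/-- The transposition of `Fin 6` corresponding to inversion in `D₃`. -/
def s₀ : Perm (Fin 6) := swap 0 1

/-- The conjugation action of `D₃` on itself, read through `label`. -/
def conjReg (g : DihedralGroup 3) : Perm (Fin 6) := label.permCongr (MulAut.conj g).toEquiv

lemma leftReg_injective : Function.Injective leftReg := by
  intro g h hgh
  have := congr($hgh (label 1))
  simpa [leftReg] using this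

lemma exists_leftReg_apply (i j : Fin 6) : ∃ g, leftReg g i = j :=
  ⟨label.symm j * (label.symm i)⁻¹, by simp [leftReg]⟩

lemma s₀_mul_self : s₀ * s₀ = 1 := swap_mul_self 0 1

lemma s₀_inv : s₀⁻¹ = s₀ := swap_inv 0 1

lemma s₀_label (g : DihedralGroup 3) : s₀ (label g) = label g⁻¹ := by
  revert g
  decide +kernel

/-- The multiplication table of `D₃`, read through `label`. -/
def mulTable : Fin 6 → Fin 6 → Fin 6 :=
  ![![1, 2, 0, 5, 3, 4], ![2, 0, 1, 4, 5, 3], ![0, 1, 2, 3, 4, 5],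
    ![4, 5, 3, 2, 0, 1], ![5, 3, 4, 1, 2, 0], ![3, 4, 5, 0, 1, 2]]

lemma coe_leftReg (g : DihedralGroup 3) : ⇑(leftReg g) = mulTable (label g) := by
  revert g
  decide +kernel

lemma commute_leftReg (g h : DihedralGroup 3) : Commute (s₀ * leftReg g * s₀) (leftReg h) := by
  ext i
  obtain ⟨k, rfl⟩ := label.surjective i
  simp [leftReg, s₀_label, mul_assoc]

lemma conjReg_commute (g : DihedralGroup 3) : conjReg g * s₀ = s₀ * conjReg g := by
  ext i
  obtain ⟨k, rfl⟩ := label.surjective i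
  simp [conjReg, s₀_label, mul_assoc]

lemma leftReg_mul_conjReg (g h : DihedralGroup 3) :
    leftReg h * conjReg g = conjReg g * leftReg (g⁻¹ * h * g) := by
  ext i
  obtain ⟨k, rfl⟩ := label.surjective i
  simp [conjReg, leftReg, mul_assoc]

lemma conjReg_one : conjReg 1 = 1 := by
  ext i
  simp [conjReg]

/-- Two non-commuting elements generate `D₃`. -/
lemma eq_top_of_mem {x y : DihedralGroup 3} (hxy : x * y ≠ y * x) {K : Subgroup (DihedralGroup 3)}
    (hx : x ∈ K) (hy : y ∈ K) (g : DihedralGroup 3) : g ∈ K := by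
  have key : ∀ x y : DihedralGroup 3, x * y ≠ y * x → ∀ g, g = 1 ∨ g = x ∨ g = y ∨ g = x * y ∨
      g = y * x ∨ g = x * y * x ∨ g = x * x ∨ g = y * y := by
    decide +kernel
  obtain h | h | h | h | h | h | h | h := key x y hxy g <;> rw [h]
  · exact one_mem K
  · exact hx
  · exact hy
  · exact mul_mem hx hy
  · exact mul_mem hy hx
  · exact mul_mem (mul_mem hx hy) hx
  · exact mul_mem hx hx
  · exact mul_mem hy hy

/-- The image of the left regular representation is the full centralizer of the image of the right
regular representation. -/
lemma exists_eq_leftReg {x y : DihedralGroup 3} (hxy : x * y ≠ y * x) {z : Perm (Fin 6)}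
    (hx : Commute (s₀ * leftReg x * s₀) z) (hy : Commute (s₀ * leftReg y * s₀) z) :
    ∃ g, z = leftReg g := by
  have h (g) : Commute (s₀ * leftReg g * s₀) z := by
    have := eq_top_of_mem hxy (K := (Subgroup.centralizer {z}).comap
      ((MulAut.conj s₀).toMonoidHom.comp leftReg))
      (by simpa [Subgroup.mem_centralizer_singleton_iff, s₀_inv] using hx.eq)
      (by simpa [Subgroup.mem_centralizer_singleton_iff, s₀_inv] using hy.eq) g
    simpa [Subgroup.mem_centralizer_singleton_iff, s₀_inv, Commute, SemiconjBy] using this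
  obtain ⟨g, hg⟩ := label.surjective (z (label 1))
  refine ⟨g, Equiv.ext fun i => ?_⟩
  obtain ⟨k, rfl⟩ := label.surjective i
  have := congr($(h k⁻¹) (label 1))
  simp [leftReg, s₀_label, ← hg] at this ⊢
  exact this.symm

set_option synthInstance.maxHeartbeats 400000 in
set_option synthInstance.maxSize 1000 in
lemma exists_eq_conjReg (d : Perm (Fin 6)) (hd : d * s₀ = s₀ * d) {x y x' y' : DihedralGroup 3}
    (hxy : x * y ≠ y * x) (hx : d * leftReg x = leftReg x' * d)
    (hy : d * leftReg y = leftReg y' * d) : ∃ g, d = conjReg g := by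
  have key : ∀ d : Perm (Fin 6), (∀ i, d (s₀ i) = s₀ (d i)) → ∀ x y : DihedralGroup 3,
      x * y ≠ y * x → (∃ x', ∀ i, d (leftReg x i) = leftReg x' (d i)) →
      (∃ y', ∀ i, d (leftReg y i) = leftReg y' (d i)) → ∃ g, ∀ i, d i = conjReg g i := by
    decide +kernel
  obtain ⟨g, hg⟩ := key d (fun i => congr($hd i)) x y hxy ⟨x', fun i => congr($hx i)⟩
    ⟨y', fun i => congr($hy i)⟩
  exact ⟨g, Equiv.ext hg⟩

/-- Representatives of the left cosets of the image of `conjReg`. -/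
@[irreducible] def reps : Finset (Perm (Fin 6)) := {c | c 3 < c 4 ∧ c 4 < c 5}

lemma card_reps : reps.card = 120 := by decide +kernel

lemma apply_conjReg (c : Perm (Fin 6)) (g : DihedralGroup 3) {i : Fin 6} (hi : 3 ≤ i) :
    c (conjReg g i) = (![0, 0, 0, c 3, c 4, c 5] : Fin 6 → Fin 6) (conjReg g i) := by
  have key : ∀ g, ∀ i : Fin 6, 3 ≤ i → conjReg g i = 3 ∨ conjReg g i = 4 ∨ conjReg g i = 5 := by
    decide +kernel
  obtain h | h | h := key g i hi <;> rw [h] <;> rfl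

lemma exists_mul_conjReg_mem_reps (c : Perm (Fin 6)) : ∃ g, c * conjReg g ∈ reps := by
  have key : ∀ u v w : Fin 6, u ≠ v → u ≠ w → v ≠ w →
      ∃ g, (![0, 0, 0, u, v, w] : Fin 6 → Fin 6) (conjReg g 3) <
          (![0, 0, 0, u, v, w] : Fin 6 → Fin 6) (conjReg g 4) ∧
        (![0, 0, 0, u, v, w] : Fin 6 → Fin 6) (conjReg g 4) <
          (![0, 0, 0, u, v, w] : Fin 6 → Fin 6) (conjReg g 5) := by
    decide +kernel
  obtain ⟨g, hg⟩ := key (c 3) (c 4) (c 5) (c.injective.ne (by decide))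
    (c.injective.ne (by decide)) (c.injective.ne (by decide))
  refine ⟨g, ?_⟩
  rw [← apply_conjReg c g (by decide), ← apply_conjReg c g (by decide),
    ← apply_conjReg c g (by decide)] at hg
  simpa [reps] using hg

lemma eq_one_of_mul_conjReg_mem_reps {c : Perm (Fin 6)} {g : DihedralGroup 3} (hc : c ∈ reps)
    (h : c * conjReg g ∈ reps) : g = 1 := by
  have key : ∀ u v w : Fin 6, u < v ∧ v < w →
      ∀ g, (![0, 0, 0, u, v, w] : Fin 6 → Fin 6) (conjReg g 3) <
          (![0, 0, 0, u, v, w] : Fin 6 → Fin 6) (conjReg g 4) ∧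
        (![0, 0, 0, u, v, w] : Fin 6 → Fin 6) (conjReg g 4) <
          (![0, 0, 0, u, v, w] : Fin 6 → Fin 6) (conjReg g 5) → g = 1 := by
    decide +kernel
  refine key (c 3) (c 4) (c 5) (by simpa [reps] using hc) g ?_
  rw [← apply_conjReg c g (by decide), ← apply_conjReg c g (by decide),
    ← apply_conjReg c g (by decide)]
  simpa [reps] using h

/-! ### Non-commuting solutions -/

lemma exists_conj_of_commute (x : Perm (Fin 6))
    (hx : ∀ i, s₀ (x (s₀ (x i))) = x (s₀ (x (s₀ i)))) :
    (∀ i, s₀ (x (s₀ i)) = x i) ∨ (∀ i, s₀ (x (s₀ (x i))) = i) ∨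
      ∃ c : Perm (Fin 6), (∀ i, c (s₀ i) = s₀ (c i)) ∧
        ((∀ i, x (c i) = c (leftReg (.sr 0) i)) ∨
          (∀ i, x (c i) = c (leftReg (.r 1) i)) ∨
          ∀ i, x (c i) = c ((swap 0 2 * swap 1 3 : Perm (Fin 6)) i)) := by
  rw [coe_leftReg, coe_leftReg, show label (.sr 0) = 3 from rfl, show label (.r 1) = 0 from rfl,
    show ⇑(swap 0 2 * swap 1 3 : Perm (Fin 6)) = ![2, 3, 0, 1, 4, 5] by decide]
  revert x
  decide +kernel

lemma exists_conj_of_mem (y : Perm (Fin 6)) (hy : ∀ i, s₀ (y (s₀ (y i))) = y (s₀ (y (s₀ i))))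
    (x : Perm (Fin 6)) (hx : x ∈ [leftReg (.sr 0), leftReg (.r 1), swap 0 2 * swap 1 3])
    (hxy : ∀ i, s₀ (x (s₀ (y i))) = y (s₀ (x (s₀ i)))) :
    (∀ i, x (y i) = y (x i)) ∨ ∃ c : Perm (Fin 6), (∀ i, c (s₀ i) = s₀ (c i)) ∧
      (∃ g, ∀ i, x (c i) = c (leftReg g i)) ∧ ∃ g, ∀ i, y (c i) = c (leftReg g i) := by
  have key : ∀ y : Perm (Fin 6), (∀ i, s₀ (y (s₀ (y i))) = y (s₀ (y (s₀ i)))) →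
      ∀ x ∈ [mulTable 3, mulTable 0, ![2, 3, 0, 1, 4, 5]],
      (∀ i, s₀ (x (s₀ (y i))) = y (s₀ (x (s₀ i)))) → (∀ i, x (y i) = y (x i)) ∨
      ∃ c ∈ [1, swap 2 3, swap 2 4, swap 2 5, s₀, s₀ * swap 2 3, s₀ * swap 2 4, s₀ * swap 2 5],
        (∀ i, c (s₀ i) = s₀ (c i)) ∧ (∃ k, ∀ i, x (c i) = c (mulTable k i)) ∧
          ∃ k, ∀ i, y (c i) = c (mulTable k i) := by
    decide +kernel
  have hx' : ⇑x ∈ [mulTable 3, mulTable 0, ![2, 3, 0, 1, 4, 5]] := by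
    have := List.mem_map_of_mem (f := fun x : Perm (Fin 6) => ⇑x) hx
    rwa [List.map_cons, List.map_cons, List.map_cons, List.map_nil, coe_leftReg, coe_leftReg,
      show label (.sr 0) = 3 from rfl, show label (.r 1) = 0 from rfl,
      show ⇑(swap 0 2 * swap 1 3 : Perm (Fin 6)) = ![2, 3, 0, 1, 4, 5] by decide] at this
  simp only [coe_leftReg]
  refine (key y hy x hx' hxy).imp_right fun ⟨c, _, h, ⟨k, hk⟩, l, hl⟩ =>
    ⟨c, h, ⟨label.symm k, ?_⟩, label.symm l, ?_⟩
  · simpa using hk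
  · simpa using hl

/-- Two non-commuting permutations, all of whose `s₀`-conjugates commute with both, are left
multiplications by elements of `D₃` for a suitable labelling. -/
lemma exists_conj_of_not_commute {x y : Perm (Fin 6)} (hx : Commute (s₀ * x * s₀) x)
    (hy : Commute (s₀ * y * s₀) y) (hxy : Commute (s₀ * x * s₀) y) (h : x * y ≠ y * x) :
    ∃ c : Perm (Fin 6), c * s₀ = s₀ * c ∧ (∃ g, x * c = c * leftReg g) ∧
      ∃ g, y * c = c * leftReg g := by
  obtain h1 | h1 | ⟨c, hc, h1⟩ := exists_conj_of_commute x fun i => by simpa using congr($hx i)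
  · have h2 : s₀ * x * s₀ = x := Equiv.ext h1
    exact absurd (h2 ▸ hxy) h
  · have h2 : s₀ * x * s₀ = x⁻¹ := eq_inv_of_mul_eq_one_left (Equiv.ext h1)
    exact absurd (by simpa using (h2 ▸ hxy).inv_left) h
  · have hc' : c * s₀ = s₀ * c := Equiv.ext hc
    have hcs : c⁻¹ * s₀ * c = s₀ := by rw [mul_assoc, ← hc', inv_mul_cancel_left]
    have conj {u v : Perm (Fin 6)} (huv : Commute (s₀ * u * s₀) v) :
        Commute (s₀ * (c⁻¹ * u * c) * s₀) (c⁻¹ * v * c) := by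
      have := huv.conj c⁻¹
      rw [inv_inv] at this
      rwa [show c⁻¹ * (s₀ * u * s₀) * c =
        c⁻¹ * s₀ * c * (c⁻¹ * u * c) * (c⁻¹ * s₀ * c) by group, hcs] at this
    obtain ⟨x', hx', hmem⟩ : ∃ x', c⁻¹ * x * c = x' ∧
        x' ∈ [leftReg (.sr 0), leftReg (.r 1), swap 0 2 * swap 1 3] := by
      refine ⟨_, rfl, ?_⟩
      obtain h1 | h1 | h1 := h1 <;>
      · have h2 := inv_mul_eq_iff_eq_mul.2 (Equiv.ext h1 : x * c = c * _)
        rw [← mul_assoc] at h2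
        rw [h2]
        simp
    have hxy' := (hx' ▸ conj hxy : Commute (s₀ * x' * s₀) (c⁻¹ * y * c)).eq
    obtain h3 | ⟨d, hd, ⟨g, hg⟩, k, hk⟩ := exists_conj_of_mem (c⁻¹ * y * c)
      (fun i => congr($((conj hy).eq) i)) x' hmem (fun i => congr($hxy' i))
    · have h4 : c⁻¹ * x * c * (c⁻¹ * y * c) = c⁻¹ * y * c * (c⁻¹ * x * c) := by
        rw [hx']
        exact Equiv.ext h3
      refine absurd (mul_right_cancel (b := c) ?_) h
      simpa [mul_assoc] using h4
    · have hg' : c⁻¹ * x * c * d = d * leftReg g := hx' ▸ Equiv.ext hg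
      have hk' : c⁻¹ * y * c * d = d * leftReg k := Equiv.ext hk
      have hd' : d * s₀ = s₀ * d := Equiv.ext hd
      refine ⟨c * d, ?_, ⟨g, ?_⟩, k, ?_⟩
      · rw [mul_assoc, hd', ← mul_assoc, hc', mul_assoc]
      · rw [mul_assoc c d, ← hg']
        group
      · rw [mul_assoc c d, ← hk']
        group

/-- A tuple of elements of `D₃`, indexed by the generators of `B` other than `σ`. -/
abbrev Quad : Type := DihedralGroup 3 × DihedralGroup 3 × DihedralGroup 3 × DihedralGroup 3

/-- The tuple `q` as a function on all generators, with value `1` at `σ`. -/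
def Quad.val (q : Quad) : Gen → DihedralGroup 3
  | .a1 => q.1
  | .a2 => q.2.1
  | .b1 => q.2.2.1
  | .b2 => q.2.2.2
  | .s => 1

/-- The tuples that define a surjection from the genus `2` surface group onto `D₃`. -/
@[irreducible] def surjections : Finset Quad :=
  {q | (q.1 * q.2.2.1⁻¹ * q.1⁻¹ * q.2.2.1) * (q.2.1 * q.2.2.2⁻¹ * q.2.1⁻¹ * q.2.2.2) = 1 ∧
    ∃ x y, q.val x * q.val y ≠ q.val y * q.val x}

lemma mem_surjections {q : Quad} : q ∈ surjections ↔
    (q.1 * q.2.2.1⁻¹ * q.1⁻¹ * q.2.2.1) * (q.2.1 * q.2.2.2⁻¹ * q.2.1⁻¹ * q.2.2.2) = 1 ∧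
      ∃ x y, q.val x * q.val y ≠ q.val y * q.val x := by
  simp [surjections]

lemma card_surjections : surjections.card = 360 := by
  decide +kernel

/-- The values on generators of the representation given by a labelling and a surjection. -/
def values (p : Perm (Fin 6) × Quad) : Gen → Perm (Fin 6)
  | .s => p.1 * s₀ * p.1⁻¹
  | x => p.1 * leftReg (p.2.val x) * p.1⁻¹

lemma values_of_ne (p : Perm (Fin 6) × Quad) {x : Gen} (hx : x ≠ .s) :
    values p x = p.1 * leftReg (p.2.val x) * p.1⁻¹ := by
  cases x <;> first | rfl | contradiction

lemma ne_of_not_commute {q : Quad} {x y : Gen} (h : q.val x * q.val y ≠ q.val y * q.val x) :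
    x ≠ .s ∧ y ≠ .s := by
  constructor <;> rintro rfl <;> simp [Quad.val] at h

lemma values_injOn : Set.InjOn values ↑(reps ×ˢ surjections) := by
  rintro ⟨c, q⟩ h ⟨c', q'⟩ h' heq
  simp only [Finset.coe_product, Set.mem_prod, Finset.mem_coe] at h h'
  obtain ⟨x, y, hxy⟩ := (mem_surjections.1 h.2).2
  have hne := ne_of_not_commute hxy
  have key {z : Gen} (hz : z ≠ .s) :
      c'⁻¹ * c * leftReg (q.val z) = leftReg (q'.val z) * (c'⁻¹ * c) := by
    have := congrFun heq z
    rw [values_of_ne _ hz, values_of_ne _ hz, mul_inv_eq_iff_eq_mul] at this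
    dsimp only at this
    rw [mul_assoc, this]
    group
  have hs : c'⁻¹ * c * s₀ = s₀ * (c'⁻¹ * c) := by
    have : c * s₀ * c⁻¹ = c' * s₀ * c'⁻¹ := congrFun heq .s
    rw [mul_inv_eq_iff_eq_mul] at this
    rw [mul_assoc, this]
    group
  obtain ⟨g, hg⟩ := exists_eq_conjReg _ hs hxy (key hne.1) (key hne.2)
  rw [inv_mul_eq_iff_eq_mul] at hg
  obtain rfl := eq_one_of_mul_conjReg_mem_reps h'.1 (hg ▸ h.1)
  obtain rfl : c = c' := by simpa [conjReg_one] using hg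
  have hq {z : Gen} (hz : z ≠ .s) : q.val z = q'.val z := leftReg_injective (by simpa using key hz)
  obtain ⟨q1, q2, q3, q4⟩ := q
  obtain ⟨r1, r2, r3, r4⟩ := q'
  obtain rfl : q1 = r1 := hq (z := .a1) nofun
  obtain rfl : q2 = r2 := hq (z := .a2) nofun
  obtain rfl : q3 = r3 := hq (z := .b1) nofun
  obtain rfl : q4 = r4 := hq (z := .b2) nofun
  rfl

/-- Every element of `reps ×ˢ surjections` comes from a generic representation. -/
lemma exists_isGeneric {c : Perm (Fin 6)} {q : Quad} (hq : q ∈ surjections) :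
    ∃ φ : B →* Perm (Fin 6), IsGeneric 6 φ ∧
      (fun x => φ (PresentedGroup.of x)) = values (c, q) := by
  obtain ⟨hTR, x, y, hxy⟩ := mem_surjections.1 hq
  have hs : values (c, q) .s * values (c, q) .s = 1 := by
    simp [values, mul_assoc, ← mul_assoc s₀ s₀, s₀_mul_self]
  have hrels : ∀ r ∈ rels, FreeGroup.lift (values (c, q)) r = 1 := by
    rw [lift_rels_iff hs]
    refine ⟨fun z hz w hw => ?_, ?_⟩
    · rw [values_of_ne _ hz, values_of_ne _ hw]
      have := (commute_leftReg (q.val z) (q.val w)).conj c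
      simpa [values, mul_assoc] using this
    · have := congr(c * leftReg ($hTR) * c⁻¹)
      simpa [values, Quad.val, mul_assoc] using this
  have hφ (z : Gen) : PresentedGroup.toGroup hrels (PresentedGroup.of z) = values (c, q) z :=
    PresentedGroup.toGroup.of hrels
  refine ⟨PresentedGroup.toGroup hrels, ⟨⟨c 0, c 1, by simp, ?_⟩, fun i j => ?_⟩, funext hφ⟩
  · rw [swap_apply_apply]
    exact hφ .s
  · obtain ⟨g, hg⟩ := exists_leftReg_apply (c⁻¹ i) (c⁻¹ j)
    have hmem {z : Gen} (hz : z ≠ .s) : q.val z ∈ (PresentedGroup.toGroup hrels).range.comap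
        ((MulAut.conj c).toMonoidHom.comp leftReg) :=
      ⟨PresentedGroup.of z, by rw [hφ, values_of_ne _ hz]; simp⟩
    have hne := ne_of_not_commute hxy
    obtain ⟨b, hb⟩ := eq_top_of_mem hxy (hmem hne.1) (hmem hne.2) g
    refine ⟨b, ?_⟩
    rw [hb]
    simp only [MonoidHom.comp_apply, MulEquiv.coe_toMonoidHom, MulAut.conj_apply,
      Perm.mul_apply, hg]
    simp

/-- If the images of the generators other than `σ` commute, the representation is not generic. -/
lemma exists_not_commute {φ : B →* Perm (Fin 6)} (hφ : IsGeneric 6 φ) {f : Gen → Perm (Fin 6)}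
    (hf : (fun x => φ (PresentedGroup.of x)) = f)
    (hcomm : ∀ x ≠ Gen.s, ∀ y ≠ Gen.s, Commute (f .s * f x * f .s) (f y)) :
    ∃ x ≠ Gen.s, ∃ y ≠ Gen.s, f x * f y ≠ f y * f x := by
  by_contra! hab
  obtain ⟨⟨p, q, hpq, hs⟩, htrans⟩ := hφ
  replace hs : f .s = swap p q := hf ▸ hs
  set s := f .s with hs_def
  have hss : s * s = 1 := by rw [hs, swap_mul_self]
  let A : Set (Perm (Fin 6)) := {a | ∃ x ≠ Gen.s, a = f x ∨ a = s * f x * s}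
  let K := Subgroup.closure A
  have hA : ∀ a ∈ A, ∀ b ∈ A, a * b = b * a := by
    rintro a ⟨x, hx, rfl | rfl⟩ b ⟨y, hy, rfl | rfl⟩
    · exact hab x hx y hy
    · exact (hcomm y hy x hx).symm
    · exact hcomm x hx y hy
    · have := congr(s * $(hab x hx y hy) * s)
      simpa [mul_assoc, ← mul_assoc s s, hss] using this
  have hK : ∀ a ∈ K, ∀ b ∈ K, a * b = b * a := by
    have := Subgroup.isMulCommutative_closure hA
    intro a ha b hb
    exact setLike_mul_comm ha hb
  have hsK : ∀ k ∈ K, s * k * s ∈ K := by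
    intro k hk
    induction hk using Subgroup.closure_induction with
    | mem a ha =>
      obtain ⟨x, hx, rfl | rfl⟩ := ha
      · exact Subgroup.subset_closure ⟨x, hx, Or.inr rfl⟩
      · refine Subgroup.subset_closure ⟨x, hx, Or.inl ?_⟩
        simp [mul_assoc, ← mul_assoc s s, hss]
    | one => simp [hss]
    | mul a b _ _ ha hb =>
      have := mul_mem ha hb
      simpa [mul_assoc, ← mul_assoc s s, hss] using this
    | inv a _ ha =>
      have := inv_mem ha
      simpa [mul_assoc, inv_eq_of_mul_eq_one_left hss] using this
  have hrange (g : B) : φ g ∈ K ∨ φ g * s ∈ K := by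
    have hg : g ∈ Subgroup.closure (Set.range (PresentedGroup.of (rels := rels))) := by
      rw [PresentedGroup.closure_range_of]
      trivial
    induction hg using Subgroup.closure_induction with
    | mem a ha =>
      obtain ⟨x, rfl⟩ := ha
      rw [show φ (PresentedGroup.of x) = f x from congrFun hf x]
      by_cases hx : x = .s
      · right
        simp [hx, ← hs_def, hss]
      · exact Or.inl (Subgroup.subset_closure ⟨x, hx, Or.inl rfl⟩)
    | one => simp
    | mul a b _ _ ha hb =>
      rw [map_mul]
      obtain ha | ha := ha <;> obtain hb | hb := hb
      · exact Or.inl (mul_mem ha hb)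
      · exact Or.inr (by simpa [mul_assoc] using mul_mem ha hb)
      · right
        have := mul_mem ha (hsK _ hb)
        simpa [mul_assoc, ← mul_assoc s s, hss] using this
      · left
        have := mul_mem ha (hsK _ hb)
        simpa [mul_assoc, ← mul_assoc s s, hss] using this
    | inv a _ ha =>
      rw [map_inv]
      obtain ha | ha := ha
      · exact Or.inl (inv_mem ha)
      · right
        have := hsK _ (inv_mem ha)
        simpa [mul_assoc, ← mul_assoc s s, hss] using this
  obtain ⟨u, v, w, hu, hv, hw, huv, huw, hvw⟩ : ∃ u v w : Fin 6, (u ≠ p ∧ u ≠ q) ∧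
      (v ≠ p ∧ v ≠ q) ∧ (w ≠ p ∧ w ≠ q) ∧ u ≠ v ∧ u ≠ w ∧ v ≠ w := by
    clear * -
    revert p q
    decide
  have hfix {i : Fin 6} (hi : i ≠ p ∧ i ≠ q) : s i = i := by
    rw [hs, swap_apply_of_ne_of_ne hi.1 hi.2]
  have htu (j : Fin 6) : ∃ k ∈ K, k u = j := by
    obtain ⟨g, hg⟩ := htrans u j
    obtain h | h := hrange g
    · exact ⟨_, h, hg⟩
    · exact ⟨_, h, by simp [hfix hu, hg]⟩
  have hreg {k l : Perm (Fin 6)} (hk : k ∈ K) (hl : l ∈ K) {i : Fin 6} (h : k i = l i) :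
      k = l := by
    ext j
    obtain ⟨m, hm, rfl⟩ := htu i
    obtain ⟨n, hn, rfl⟩ := htu j
    have hmn : n * m⁻¹ ∈ K := mul_mem hn (inv_mem hm)
    have h1 := congr($(hK k hk _ hmn) (m u))
    have h2 := congr($(hK l hl _ hmn) (m u))
    simp only [Perm.mul_apply, Perm.coe_inv, symm_apply_apply] at h1 h2
    rw [h1, h2, h]
  have hswap {i : Fin 6} (hi : i ≠ p ∧ i ≠ q) (hui : u ≠ i) : ∃ k ∈ K, k u = i ∧ k p = q := by
    obtain ⟨k, hk, hki⟩ := htu i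
    refine ⟨k, hk, hki, ?_⟩
    have h1 : s * k * s = k := hreg (hsK k hk) hk (i := u) (by simp [hfix hu, hki, hfix hi])
    have h2 : s (k q) = k p := by
      have := congr($h1 p)
      simpa [hs] using this
    by_contra hne
    by_cases hp : k p = p
    · have : k = 1 := hreg hk (one_mem K) hp
      exact hui (by simpa [this] using hki)
    · have h3 : k q = k p := by
        rw [← hfix ⟨hp, hne⟩] at h2
        exact s.injective h2
      exact hpq (k.injective h3).symm
  obtain ⟨k, hk, hkv, hkp⟩ := hswap hv huv
  obtain ⟨l, hl, hlw, hlp⟩ := hswap hw huw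
  obtain rfl := hreg hk hl (hkp.trans hlp.symm)
  exact hvw (hkv.symm.trans hlw)

lemma exists_values_eq {φ : B →* Perm (Fin 6)} (hφ : IsGeneric 6 φ) :
    ∃ c ∈ reps, ∃ q ∈ surjections, values (c, q) = fun x => φ (PresentedGroup.of x) := by
  obtain ⟨f, hf⟩ : ∃ f, (fun x => φ (PresentedGroup.of x)) = f := ⟨_, rfl⟩
  obtain ⟨p, q, hpq, hs⟩ := id hφ.1
  replace hs : f .s = swap p q := hf ▸ hs
  obtain ⟨hcomm, hTR⟩ := (lift_rels_iff (f := f) (by rw [hs, swap_mul_self])).1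
    fun r hr => hf ▸ lift_eq_one φ hr
  obtain ⟨x, hx, y, hy, hxy⟩ := exists_not_commute hφ hf hcomm
  rw [hf]
  obtain ⟨c₀, rfl, rfl⟩ : ∃ c : Perm (Fin 6), c 0 = p ∧ c 1 = q := by
    refine ⟨swap (swap 0 p 1) q * swap 0 p, ?_, ?_⟩
    · rw [Perm.mul_apply, swap_apply_left]
      refine swap_apply_of_ne_of_ne (fun h => ?_) hpq
      exact absurd ((swap 0 p).injective ((swap_apply_left 0 p).trans h)) (by decide)
    · simp
  have hs0 : f .s = c₀ * s₀ * c₀⁻¹ := by rw [hs, swap_apply_apply, s₀]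
  have hcomm' (z) (hz : z ≠ Gen.s) (w) (hw : w ≠ Gen.s) :
      Commute (s₀ * (c₀⁻¹ * f z * c₀) * s₀) (c₀⁻¹ * f w * c₀) := by
    have := (hcomm z hz w hw).conj c₀⁻¹
    simpa [hs0, mul_assoc] using this
  obtain ⟨c₁, hc₁, ⟨g, hg⟩, h, hh⟩ := exists_conj_of_not_commute (hcomm' x hx x hx)
    (hcomm' y hy y hy) (hcomm' x hx y hy) fun h =>
      hxy (mul_right_cancel (b := c₀) (by simpa [mul_assoc] using h))
  obtain ⟨k, hk⟩ := exists_mul_conjReg_mem_reps (c₀ * c₁)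
  set c := c₀ * c₁ * conjReg k with hc
  have hsc : f .s = c * s₀ * c⁻¹ := by
    rw [eq_mul_inv_iff_mul_eq, hs0, hc, mul_assoc (c₀ * c₁), conjReg_commute,
      ← mul_assoc (c₀ * c₁) s₀, mul_assoc c₀ c₁ s₀, hc₁]
    group
  have hcomm'' (z) (hz : z ≠ Gen.s) (w) (hw : w ≠ Gen.s) :
      Commute (s₀ * (c⁻¹ * f z * c) * s₀) (c⁻¹ * f w * c) := by
    have := (hcomm z hz w hw).conj c⁻¹
    simpa [hsc, mul_assoc] using this
  have conj {z : Gen} {t : DihedralGroup 3} (ht : c₀⁻¹ * f z * c₀ * c₁ = c₁ * leftReg t) :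
      c⁻¹ * f z * c = leftReg (k⁻¹ * t * k) := by
    rw [mul_assoc, inv_mul_eq_iff_eq_mul, hc, mul_assoc _ (conjReg k), ← leftReg_mul_conjReg,
      ← mul_assoc _ (leftReg t), mul_assoc c₀ c₁ (leftReg t), ← ht]
    group
  have hx' := conj hg
  have hy' := conj hh
  have hne : k⁻¹ * g * k * (k⁻¹ * h * k) ≠ k⁻¹ * h * k * (k⁻¹ * g * k) := by
    intro heq
    have := congr(leftReg $heq)
    rw [map_mul leftReg, map_mul leftReg (k⁻¹ * h * k), ← hx', ← hy'] at this
    exact hxy (mul_right_cancel (b := c) (by simpa [mul_assoc] using this))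
  have hex (z : Gen) : ∃ t, z ≠ .s → c⁻¹ * f z * c = leftReg t := by
    by_cases hz : z = .s
    · exact ⟨1, fun h => absurd hz h⟩
    · obtain ⟨t, ht⟩ := exists_eq_leftReg hne (hx' ▸ hcomm'' x hx z hz) (hy' ▸ hcomm'' y hy z hz)
      exact ⟨t, fun _ => ht⟩
  choose t ht using hex
  have hval {z : Gen} (hz : z ≠ .s) : Quad.val (t .a1, t .a2, t .b1, t .b2) z = t z := by
    cases z <;> first | rfl | contradiction
  have hfz {z : Gen} (hz : z ≠ .s) : f z = c * leftReg (t z) * c⁻¹ := by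
    rw [← ht z hz]
    group
  refine ⟨c, hk, (t .a1, t .a2, t .b1, t .b2), ?_, ?_⟩
  · refine mem_surjections.2 ⟨leftReg_injective ?_, x, y, ?_⟩
    · rw [hfz (z := .a1) nofun, hfz (z := .a2) nofun, hfz (z := .b1) nofun,
        hfz (z := .b2) nofun] at hTR
      have := congr(c⁻¹ * ($hTR) * c)
      simpa [mul_assoc] using this
    · rw [hval hx, hval hy]
      intro heq
      refine hxy ?_
      rw [hfz hx, hfz hy]
      have := congr(c * leftReg ($heq) * c⁻¹)
      simpa [mul_assoc] using this
  · funext z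
    by_cases hz : z = .s
    · rw [hz, hsc]
      rfl
    · rw [values_of_ne _ hz, hval hz, hfz hz]

end Braid

/-- There are exactly 43200 generic monodromy representations of B in S₆. -/
theorem stmt10 :
    Set.ncard {φ : B →* Equiv.Perm (Fin 6) | IsGeneric 6 φ} = 43200 := by
  have himage : (fun (φ : B →* Equiv.Perm (Fin 6)) x => φ (PresentedGroup.of x)) ''
      {φ | IsGeneric 6 φ} = values '' ↑(reps ×ˢ surjections) := by
    ext f
    constructor
    · rintro ⟨φ, hφ, rfl⟩
      obtain ⟨c, hc, q, hq, h⟩ := exists_values_eq hφ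
      exact ⟨(c, q), Finset.mem_coe.2 (Finset.mem_product.2 ⟨hc, hq⟩), h⟩
    · rintro ⟨⟨c, q⟩, hcq, rfl⟩
      obtain ⟨φ, hφ, h⟩ := exists_isGeneric (c := c) (Finset.mem_product.1 hcq).2
      exact ⟨φ, hφ, h⟩
  rw [← Set.ncard_image_of_injective _ fun _ _ => hom_ext, himage,
    values_injOn.ncard_image, Set.ncard_coe_finset, Finset.card_product, card_reps,
    card_surjections]
end

section
/- There are exactly 4838400 (= 28 · 172800) generic monodromy representations of B in S₈, i.e. the set of group homomorphisms φ: B → S₈ such that φ(σ) is a transposition and the image of φ is a transitive subgroup of S₈ has cardinality 4838400. -/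
open Braid

namespace SurfaceBraid

open Equiv Equiv.Perm Pointwise

section Blocks

variable {α : Type*}

theorem commute_conj_of_mem_closure {ι : Type*} {s : Perm α} (hs : s * s = 1) {x : ι → Perm α}
    (h : ∀ i j, Commute (s * x i * s) (x j)) {g k : Perm α}
    (hg : g ∈ Subgroup.closure (Set.range x)) (hk : k ∈ Subgroup.closure (Set.range x)) :
    Commute (s * g * s) k := by
  induction hg, hk using Subgroup.closure_induction₂ with
  | mem _ _ hx hy =>
    obtain ⟨i, rfl⟩ := hx
    obtain ⟨j, rfl⟩ := hy
    exact h i j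
  | one_left y _ => simp [hs]
  | one_right x _ => simp
  | mul_left a b y _ _ _ h₁ h₂ =>
    have : s * (a * b) * s = (s * a * s) * (s * b * s) := by
      calc s * (a * b) * s = s * a * 1 * b * s := by group
        _ = _ := by rw [← hs]; group
    rw [this]
    exact h₁.mul_left h₂
  | mul_right y a b _ _ _ h₁ h₂ => exact h₁.mul_right h₂
  | inv_left a y _ _ h₁ =>
    have hs' : s⁻¹ = s := inv_eq_of_mul_eq_one_right hs
    have : s * a⁻¹ * s = (s * a * s)⁻¹ := by simp [hs', mul_assoc]
    rw [this]
    exact h₁.inv_left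
  | inv_right y a _ _ h₁ => exact h₁.inv_right

/-- If the translates of `D` by the group generated by `S` are disjoint from `D` or equal to it, and
the support of `s` lies in `D`, then `D` is a block for the group generated by `s` and `S`. -/
theorem isBlock_of_translates {S : Set (Perm α)} {D : Set α} {s : Perm α} (hs : s * s = 1)
    (hsD : s • D = D) (hsD' : ∀ P ∉ D, s P = P)
    (hD : ∀ g ∈ Subgroup.closure S, g • D = D ∨ Disjoint (g • D) D) :
    MulAction.IsBlock (Subgroup.closure (insert s S)) D := by
  have hfix : ∀ g ∈ Subgroup.closure S, s • g • D = g • D := by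
    intro g hg
    rcases hD g hg with h | h
    · rw [h, hsD]
    · ext P
      rw [Set.mem_smul_set_iff_inv_smul_mem, inv_eq_of_mul_eq_one_right hs]
      constructor <;> intro hP
      · have : s • s • P = s • P := hsD' _ (Set.disjoint_left.1 h hP)
        rw [smul_smul, hs, one_smul] at this
        rwa [← this] at hP
      · rw [show s • P = P from hsD' _ (Set.disjoint_left.1 h hP)]
        exact hP
  have hle : S ⊆ Subgroup.closure S := Subgroup.subset_closure
  have key : ∀ g ∈ Subgroup.closure (insert s S), ∃ k ∈ Subgroup.closure S, g • D = k • D := by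
    intro g hg
    induction hg using Subgroup.closure_induction_left with
    | one => exact ⟨1, one_mem _, rfl⟩
    | mul_left x hx y _ ih =>
      obtain ⟨k, hk, hyk⟩ := ih
      rcases hx with rfl | hx
      · exact ⟨k, hk, by rw [mul_smul, hyk, hfix k hk]⟩
      · exact ⟨x * k, mul_mem (hle hx) hk, by rw [mul_smul, hyk, mul_smul]⟩
    | inv_mul_cancel x hx y _ ih =>
      obtain ⟨k, hk, hyk⟩ := ih
      rcases hx with rfl | hx
      · exact ⟨k, hk, by rw [inv_eq_of_mul_eq_one_right hs, mul_smul, hyk, hfix k hk]⟩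
      · exact ⟨x⁻¹ * k, mul_mem (inv_mem (hle hx)) hk, by rw [mul_smul, hyk, mul_smul]⟩
  rw [MulAction.isBlock_iff_smul_eq_or_disjoint]
  rintro ⟨g, hg⟩
  obtain ⟨k, hk, h⟩ := key g hg
  have : (⟨g, hg⟩ : Subgroup.closure (insert s S)) • D = k • D := h
  rw [this]
  exact hD k hk

/-- A fixed-point-free involution commuting with all the `x i` and with `s`. -/
structure IsFlip (s : Perm α) (x : Fin 4 → Perm α) (z : Perm α) : Prop where
  mul_self : z * z = 1
  ne : ∀ P, z P ≠ P
  comm_s : Commute z s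
  comm_x : ∀ i, Commute z (x i)

theorem IsFlip.conj {s : Perm α} {x : Fin 4 → Perm α} {z : Perm α} (h : IsFlip s x z)
    (t : Perm α) :
    IsFlip (MulAut.conj t s) (fun i => MulAut.conj t (x i)) (MulAut.conj t z) where
  mul_self := by rw [← map_mul, h.mul_self, map_one]
  ne P hP := h.ne (t⁻¹ P) (by simpa [← Perm.eq_inv_iff_eq] using hP)
  comm_s := h.comm_s.map _
  comm_x i := (h.comm_x i).map _

variable [DecidableEq α]

/-- The images `s`, `x i` of the generators of `B` in the case where `s` is a transposition, so that
the braid relations say that the `x i` commute with the `s * x j * s`. -/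
structure IsRep (s : Perm α) (x : Fin 4 → Perm α) : Prop where
  isSwap : s.IsSwap
  comm : ∀ i j, Commute (s * x i * s) (x j)
  surface : x 0 * (x 2)⁻¹ * (x 0)⁻¹ * x 2 * (x 1 * (x 3)⁻¹ * (x 1)⁻¹ * x 3) = 1
  trans : ∀ P Q, ∃ g ∈ Subgroup.closure (insert s (Set.range x)), g P = Q

/-- A permutation commuting with its conjugate by the transposition `(c d)` preserves `{c, d}`,
moves it off itself, or has a three-cycle containing `c` and `d`. -/
theorem pair_cases {c d : α} (hcd : c ≠ d) {x : Perm α}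
    (h : Commute (swap c d * x * swap c d) x) :
    (x c = c ∧ x d = d) ∨ (x c = d ∧ x d = c) ∨
      (x c ≠ c ∧ x c ≠ d ∧ x d ≠ c ∧ x d ≠ d) ∨
      (x c = d ∧ x d ≠ c ∧ x d ≠ d ∧ x (x d) = c) ∨
      (x d = c ∧ x c ≠ d ∧ x c ≠ c ∧ x (x c) = d) := by
  have key : ∀ P, swap c d (x (swap c d (x P))) = x (swap c d (x (swap c d P))) := fun P => by
    simpa using Equiv.congr_fun h.eq P
  have hc := key c
  have hd := key d
  have hinj := x.injective
  simp only [swap_apply_left, swap_apply_right] at hc hd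
  by_cases h1 : x c = c
  · have h2 : x d ≠ c := fun h => hcd (hinj (h1.trans h.symm))
    by_cases h3 : x d = d
    · simp [*]
    · rw [h1, swap_apply_left, swap_apply_of_ne_of_ne h2 h3] at hc
      have := hinj hc.symm
      grind
  by_cases h1' : x c = d
  · by_cases h3 : x d = c
    · simp [*]
    · have h2 : x d ≠ d := fun h => hcd (hinj (h1'.trans h.symm))
      rw [h1', swap_apply_right, swap_apply_of_ne_of_ne h3 h2, h1'] at hc
      grind
  by_cases h4 : x d = d
  · rw [h4, swap_apply_right, swap_apply_of_ne_of_ne h1 h1'] at hd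
    have := hinj hd.symm
    grind
  by_cases h5 : x d = c
  · rw [h5, swap_apply_left, swap_apply_of_ne_of_ne h1 h1', h5] at hd
    grind
  · grind

theorem IsRep.mul_self {s : Perm α} {x : Fin 4 → Perm α} (h : IsRep s x) : s * s = 1 := by
  obtain ⟨c, d, -, rfl⟩ := h.isSwap
  exact swap_mul_self c d

theorem IsRep.comm_of_mem {s : Perm α} {x : Fin 4 → Perm α} (h : IsRep s x) {g k : Perm α}
    (hg : g ∈ Subgroup.closure (Set.range x)) (hk : k ∈ Subgroup.closure (Set.range x)) :
    Commute (s * g * s) k :=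
  commute_conj_of_mem_closure h.mul_self h.comm hg hk

theorem IsRep.isPretransitive {s : Perm α} {x : Fin 4 → Perm α} (h : IsRep s x) :
    MulAction.IsPretransitive (Subgroup.closure (insert s (Set.range x))) α :=
  ⟨fun P Q => by
    obtain ⟨g, hg, hgP⟩ := h.trans P Q
    exact ⟨⟨g, hg⟩, hgP⟩⟩

theorem IsRep.three_dvd_card [Fintype α] {c d : α} (hcd : c ≠ d) {x : Fin 4 → Perm α}
    (h : IsRep (swap c d) x) {g : Perm α} (hg : g ∈ Subgroup.closure (Set.range x))
    (h1 : g c = d) (h2 : g d ≠ c) (h3 : g d ≠ d) (h4 : g (g d) = c) : 3 ∣ Fintype.card α := by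
  set e := g d with he
  have hce : c ≠ e := h2.symm
  have hde : d ≠ e := h3.symm
  have hD : ∀ k ∈ Subgroup.closure (Set.range x),
      k • ({c, d, e} : Set α) = {c, d, e} ∨ Disjoint (k • ({c, d, e} : Set α)) {c, d, e} := by
    intro k hk
    have key : ∀ P, k ((swap c d * g * swap c d) P) = (swap c d * g * swap c d) (k P) := fun P => by
      simpa using (Equiv.congr_fun (h.comm_of_mem hg hk).eq P).symm
    set r := swap c d * g * swap c d with hr
    have rc : r c = e := by simp [hr, ← he, swap_apply_of_ne_of_ne h2 h3]
    have rd : r d = c := by simp [hr, h1]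
    have re : r e = d := by simp [hr, swap_apply_of_ne_of_ne h2 h3, h4]
    have hrD : ∀ P, P = c ∨ P = d ∨ P = e → r P = c ∨ r P = d ∨ r P = e := by
      rintro P (rfl | rfl | rfl) <;> simp [rc, rd, re]
    have kc := hrD (k c)
    have kd := hrD (k d)
    have ke := hrD (k e)
    rw [← key, rc] at kc
    rw [← key, rd] at kd
    rw [← key, re] at ke
    by_cases hdis : Disjoint (k • ({c, d, e} : Set α)) {c, d, e}
    · exact Or.inr hdis
    · left
      obtain ⟨Q, ⟨P, hP, hPQ⟩, hQ⟩ := Set.not_disjoint_iff.1 hdis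
      apply Set.eq_of_subset_of_ncard_le
      · rintro R ⟨T, hT, rfl⟩
        simp only [Set.mem_insert_iff, Set.mem_singleton_iff, Perm.smul_def] at hP hQ hT hPQ ⊢
        grind
      · rw [Set.ncard_smul_set]
      · exact Set.toFinite _
  have hblock := isBlock_of_translates h.mul_self (S := Set.range x) (D := {c, d, e})
    (by
      ext P
      rw [Set.mem_smul_set_iff_inv_smul_mem, swap_inv, Perm.smul_def]
      simp only [Set.mem_insert_iff, Set.mem_singleton_iff]
      grind)
    (by
      intro P hP
      simp only [Set.mem_insert_iff, Set.mem_singleton_iff, not_or] at hP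
      exact swap_apply_of_ne_of_ne hP.1 hP.2.1) hD
  have := h.isPretransitive
  have hdvd := hblock.ncard_dvd_card ⟨c, by simp⟩
  rwa [Set.ncard_eq_toFinset_card', Nat.card_eq_fintype_card,
    show ({c, d, e} : Set α).toFinset.card = 3 by simp [hcd, hce, hde]] at hdvd

theorem IsRep.isBlock_pair [Fintype α] (hα : ¬ 3 ∣ Fintype.card α) {c d : α} (hcd : c ≠ d)
    {x : Fin 4 → Perm α} (h : IsRep (swap c d) x) :
    MulAction.IsBlock (Subgroup.closure (insert (swap c d) (Set.range x))) ({c, d} : Set α) := by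
  apply isBlock_of_translates h.mul_self
  · ext P
    rw [Set.mem_smul_set_iff_inv_smul_mem, swap_inv, Perm.smul_def]
    simp only [Set.mem_insert_iff, Set.mem_singleton_iff]
    grind
  · intro P hP
    simp only [Set.mem_insert_iff, Set.mem_singleton_iff, not_or] at hP
    exact swap_apply_of_ne_of_ne hP.1 hP.2
  · intro g hg
    rw [← Set.image_smul, Set.image_pair]
    simp only [Perm.smul_def]
    rcases pair_cases hcd (h.comm_of_mem hg hg) with ⟨h1, h2⟩ | ⟨h1, h2⟩ | h1 | h1 | h1
    · simp [h1, h2]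
    · simp [h1, h2, Set.pair_comm]
    · right
      rw [Set.disjoint_left]
      simp only [Set.mem_insert_iff, Set.mem_singleton_iff]
      grind
    · exact absurd (h.three_dvd_card hcd hg h1.1 h1.2.1 h1.2.2.1 h1.2.2.2) hα
    · rw [swap_comm] at h
      exact absurd (h.three_dvd_card hcd.symm hg h1.1 h1.2.1 h1.2.2.1 h1.2.2.2) hα

theorem IsRep.exists_isFlip [Fintype α] (hα : ¬ 3 ∣ Fintype.card α) {s : Perm α}
    {x : Fin 4 → Perm α} (h : IsRep s x) : ∃ z, IsFlip s x z := by
  obtain ⟨c, d, hcd, rfl⟩ := h.isSwap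
  set G := Subgroup.closure (insert (swap c d) (Set.range x)) with hG
  have hblock : MulAction.IsBlock G ({c, d} : Set α) := h.isBlock_pair hα hcd
  have hsG : swap c d ∈ G := Subgroup.subset_closure (Set.mem_insert _ _)
  have hstab : ∀ g ∈ G, g c = c → g d = d := by
    intro g hg hgc
    have h1 : (⟨g, hg⟩ : G) • ({c, d} : Set α) = {c, d} :=
      hblock.smul_eq_of_mem (a := c) (by simp) (by simp [Subgroup.smul_def, hgc])
    have h2 : g d ∈ ({c, d} : Set α) := by
      rw [← h1]
      exact ⟨d, by simp, rfl⟩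
    rcases h2 with h2 | h2
    · exact absurd (g.injective (hgc.trans h2.symm)) hcd
    · exact h2
  choose t ht htc using fun P => h.trans c P
  have key : ∀ g ∈ G, ∀ P, t (g P) d = g (t P d) := by
    intro g hg P
    have := hstab ((t (g P))⁻¹ * (g * t P))
      (mul_mem (inv_mem (ht _)) (mul_mem hg (ht _)))
      (by rw [Perm.mul_apply, Perm.mul_apply, htc, Perm.inv_eq_iff_eq, htc])
    rw [Perm.mul_apply, Perm.inv_eq_iff_eq] at this
    exact this.symm
  have key' : ∀ g ∈ G, t (g c) d = g d := by
    intro g hg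
    rw [key g hg, hstab (t c) (ht c) (htc c)]
  have hinv : Function.Involutive fun P => t P d := by
    intro P
    change t (t P d) d = P
    have h1 := key' (t P * swap c d) (mul_mem (ht P) hsG)
    simpa [htc] using h1
  have hcomm : ∀ g ∈ G, Commute hinv.toPerm g := by
    intro g hg
    ext P
    exact key g hg P
  refine ⟨hinv.toPerm, ?_, ?_, hcomm _ hsG, fun i => hcomm _ (Subgroup.subset_closure (by simp))⟩
  · ext P
    exact hinv P
  · intro P hP
    exact hcd ((t P).injective ((htc P).trans hP.symm))

theorem IsFlip.apply_left {c d : α} (hcd : c ≠ d) {x : Fin 4 → Perm α} {z : Perm α}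
    (hz : IsFlip (swap c d) x z) : z c = d := by
  by_contra hne
  have h1 := Equiv.congr_fun hz.comm_s.eq c
  simp only [Perm.mul_apply, swap_apply_left, swap_apply_of_ne_of_ne (hz.ne c) hne] at h1
  exact hcd (z.injective h1).symm

theorem IsFlip.unique {s : Perm α} {x : Fin 4 → Perm α} (h : IsRep s x) {z z' : Perm α}
    (hz : IsFlip s x z) (hz' : IsFlip s x z') : z = z' := by
  obtain ⟨c, d, hcd, rfl⟩ := h.isSwap
  have hG : ∀ {z}, IsFlip (swap c d) x z → ∀ g ∈ Subgroup.closure (insert (swap c d) (Set.range x)),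
      Commute z g := by
    intro z hz g hg
    induction hg using Subgroup.closure_induction with
    | mem y hy =>
      rcases hy with rfl | ⟨i, rfl⟩
      · exact hz.comm_s
      · exact hz.comm_x i
    | one => exact Commute.one_right z
    | mul _ _ _ _ h₁ h₂ => exact h₁.mul_right h₂
    | inv _ _ h₁ => exact h₁.inv_right
  ext P
  obtain ⟨g, hg, rfl⟩ := h.trans c P
  have h1 := Equiv.congr_fun (hG hz g hg).eq c
  have h2 := Equiv.congr_fun (hG hz' g hg).eq c
  simp only [Perm.mul_apply, hz.apply_left hcd, hz'.apply_left hcd] at h1 h2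
  rw [h1, h2]

theorem IsFlip.cycleType [Fintype α] {s : Perm α} {x : Fin 4 → Perm α} {z : Perm α}
    (hα : Fintype.card α = 8) (hz : IsFlip s x z) : z.cycleType = {2, 2, 2, 2} := by
  have : Fact (Nat.Prime 2) := ⟨Nat.prime_two⟩
  have h1 := cycleType_of_pow_prime_eq_one (p := 2) (σ := z) (by rw [pow_two, hz.mul_self])
  have h2 : z.support = Finset.univ := by
    ext P
    simp [hz.ne P]
  have h3 := z.sum_cycleType
  rw [h2, Finset.card_univ, hα, h1, Multiset.sum_replicate] at h3
  rw [h1, show z.cycleType.card = 4 by rw [smul_eq_mul] at h3; omega]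
  rfl

theorem IsRep.permCongr {β : Type*} [DecidableEq β] (e : α ≃ β) {s : Perm α}
    {x : Fin 4 → Perm α} (h : IsRep s x) :
    IsRep (e.permCongrHom s) (fun i => e.permCongrHom (x i)) where
  isSwap := by
    obtain ⟨c, d, hcd, rfl⟩ := h.isSwap
    exact ⟨e c, e d, e.injective.ne hcd, e.symm_trans_swap_trans c d⟩
  comm i j := by
    rw [← map_mul, ← map_mul]
    exact (h.comm i j).map _
  surface := by
    simp only [← map_mul, ← map_inv, h.surface, map_one]
  trans P Q := by
    obtain ⟨g, hg, hgP⟩ := h.trans (e.symm P) (e.symm Q)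
    refine ⟨e.permCongrHom g, ?_, ?_⟩
    · have h1 := Subgroup.mem_map_of_mem e.permCongrHom.toMonoidHom hg
      rw [MonoidHom.map_closure, Set.image_insert_eq, ← Set.range_comp] at h1
      exact h1
    · change e (g (e.symm P)) = Q
      rw [hgP, e.apply_symm_apply]

theorem IsRep.conj {s : Perm α} {x : Fin 4 → Perm α} (h : IsRep s x) (t : Perm α) :
    IsRep (MulAut.conj t s) (fun i => MulAut.conj t (x i)) :=
  h.permCongr t

end Blocks

section Model

/-- Four pairs of points, the pairs being indexed by the vectors of a plane over `𝔽₂`. -/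
abbrev Pt := (Bool × Bool) × Bool

abbrev Vec := Bool × Bool

def vadd (u v : Vec) : Vec := (u.1 ^^ v.1, u.2 ^^ v.2)

def dotp (u v : Vec) : Bool := (u.1 && v.1) ^^ (u.2 && v.2)

def symp (u v : Vec) : Bool := (u.1 && v.2) ^^ (u.2 && v.1)

/-- The permutation of `Pt` that translates the pairs by `u.1` and changes the second coordinate by
the affine function with linear part `u.2` and constant `c`. -/
def aff (u : Vec × Vec) (c : Bool) : Perm Pt where
  toFun P := (vadd P.1 u.1, P.2 ^^ dotp u.2 P.1 ^^ c)
  invFun P := (vadd P.1 u.1, P.2 ^^ dotp u.2 P.1 ^^ dotp u.2 u.1 ^^ c)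
  left_inv := by
    revert u c
    decide +kernel
  right_inv := by
    revert u c
    decide +kernel

/-- The exchange of the two points of every pair. -/
def flip : Perm Pt := aff ((false, false), (false, false)) true

def pairSwap (j : Vec) : Perm Pt := swap (j, false) (j, true)

/-- The commutation condition on the linear data of affine permutations. -/
def Compat (u v : Vec × Vec) : Prop := (dotp u.2 v.1 ^^ dotp v.2 u.1) = symp u.1 v.1

instance (u v : Vec × Vec) : Decidable (Compat u v) := inferInstanceAs (Decidable (_ = _))

theorem compat_comm : ∀ u v, Compat u v → Compat v u := by decide +kernel

theorem compat_self : ∀ u, Compat u u := by decide +kernel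

theorem pairSwap_apply (j : Vec) (P : Pt) : pairSwap j P = (P.1, P.2 ^^ decide (P.1 = j)) := by
  revert j P
  decide +kernel

theorem aff_apply (u : Vec × Vec) (c : Bool) (P : Pt) :
    aff u c P = (vadd P.1 u.1, P.2 ^^ dotp u.2 P.1 ^^ c) := rfl

theorem aff_inv (u : Vec × Vec) (c : Bool) : (aff u c)⁻¹ = aff u (dotp u.2 u.1 ^^ c) := by
  rw [inv_eq_iff_mul_eq_one, Equiv.ext_iff]
  simp only [Perm.mul_apply, aff_apply, Perm.one_apply]
  revert u c
  decide +kernel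

theorem commute_aff_iff (j : Vec) (u v : Vec × Vec) (c d : Bool) :
    Commute (pairSwap j * aff u c * pairSwap j) (aff v d) ↔ Compat u v := by
  rw [commute_iff_eq, Equiv.ext_iff]
  simp only [Perm.mul_apply, pairSwap_apply, aff_apply]
  revert j u v c d
  decide +kernel

theorem commutator_aff (u v : Vec × Vec) (c d : Bool) :
    aff u c * (aff v d)⁻¹ * (aff u c)⁻¹ * aff v d =
      aff ((false, false), (false, false)) (dotp u.2 v.1 ^^ dotp v.2 u.1) := by
  rw [Equiv.ext_iff]
  simp only [Perm.mul_apply, aff_inv, aff_apply]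
  revert u v c d
  decide +kernel

/-- The conditions on the linear data for affine permutations to give a representation. -/
structure Good (u : Fin 4 → Vec × Vec) : Prop where
  compat : ∀ i j, Compat (u i) (u j)
  symp_eq : symp (u 0).1 (u 2).1 = symp (u 1).1 (u 3).1
  span : ∃ i j, symp (u i).1 (u j).1 = true

theorem aff_zero_mul_eq_one_iff (c d : Bool) :
    aff ((false, false), (false, false)) c * aff ((false, false), (false, false)) d = 1 ↔
      c = d := by
  rw [Equiv.ext_iff]
  simp only [Perm.mul_apply, aff_apply, Perm.one_apply]
  revert c d
  decide +kernel

theorem flip_apply (P : Pt) : flip P = (P.1, !P.2) := by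
  revert P
  decide +kernel

theorem flip_commute_aff (u : Vec × Vec) (c : Bool) : Commute flip (aff u c) := by
  rw [commute_iff_eq, Equiv.ext_iff, flip]
  simp only [Perm.mul_apply, aff_apply]
  revert u c
  decide +kernel

theorem isFlip_aff {u : Fin 4 → Vec × Vec} (c : Fin 4 → Bool) (j : Vec) :
    IsFlip (pairSwap j) (fun i => aff (u i) (c i)) flip where
  mul_self := (aff_zero_mul_eq_one_iff _ _).2 rfl
  ne := by decide +kernel
  comm_s := by
    rw [commute_iff_eq, Equiv.ext_iff, flip]
    simp only [Perm.mul_apply, pairSwap_apply, aff_apply]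
    revert j
    decide +kernel
  comm_x i := flip_commute_aff _ _

theorem apply_eq_of_commute_flip {g : Perm Pt} (hg : Commute flip g) (P : Pt) :
    g P = ((g (P.1, false)).1, P.2 ^^ (g (P.1, false)).2) := by
  obtain ⟨i, b⟩ := P
  cases b
  · simp
  · have := Equiv.congr_fun hg.eq (i, false)
    simp only [Perm.mul_apply, flip_apply, Bool.not_false] at this
    rw [← this]
    simp

theorem eq_translate_of_symp : ∀ p q j k : Vec, symp p q = true →
    k = j ∨ k = vadd j p ∨ k = vadd j q ∨ k = vadd (vadd j q) p := by
  decide +kernel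

theorem Good.isRep {u : Fin 4 → Vec × Vec} (h : Good u) (c : Fin 4 → Bool) (j : Vec) :
    IsRep (pairSwap j) (fun i => aff (u i) (c i)) where
  isSwap := ⟨(j, false), (j, true), by simp, rfl⟩
  comm i i' := (commute_aff_iff _ _ _ _ _).2 (h.compat i i')
  surface := by
    rw [commutator_aff, commutator_aff, aff_zero_mul_eq_one_iff]
    have h1 := h.compat 0 2
    have h2 := h.compat 1 3
    rw [Compat] at h1 h2
    rw [h1, h2, h.symp_eq]
  trans := by
    set x : Fin 4 → Perm Pt := fun i => aff (u i) (c i)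
    set G := Subgroup.closure (insert (pairSwap j) (Set.range x)) with hG
    have hs : pairSwap j ∈ G := Subgroup.subset_closure (Set.mem_insert _ _)
    have hx : ∀ i, x i ∈ G := fun i =>
      Subgroup.subset_closure (Set.mem_insert_of_mem _ (Set.mem_range_self i))
    obtain ⟨i, i', hi⟩ := h.span
    have hpair : ∀ k b, ∃ g ∈ G, ∃ b', g (j, b') = (k, b) := by
      intro k b
      have hlift : ∀ g ∈ G, Commute flip g → (g (j, false)).1 = k →
          ∃ g ∈ G, ∃ b', g (j, b') = (k, b) := by
        intro g hg hfg hk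
        refine ⟨g, hg, b ^^ (g (j, false)).2, ?_⟩
        rw [apply_eq_of_commute_flip hfg, hk]
        simp
      have hf : ∀ i, Commute flip (x i) := fun i => flip_commute_aff _ _
      rcases eq_translate_of_symp _ _ j k hi with hk | hk | hk | hk
      · exact hlift 1 (one_mem _) (Commute.one_right _) hk.symm
      · exact hlift (x i) (hx i) (hf i) hk.symm
      · exact hlift (x i') (hx i') (hf i') hk.symm
      · exact hlift (x i * x i') (mul_mem (hx i) (hx i')) ((hf i).mul_right (hf i')) hk.symm
    have hbase : ∀ P, ∃ g ∈ G, g (j, false) = P := by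
      rintro ⟨k, b⟩
      obtain ⟨g, hg, b', hgb⟩ := hpair k b
      cases b'
      · exact ⟨g, hg, hgb⟩
      · refine ⟨g * pairSwap j, mul_mem hg hs, ?_⟩
        rw [Perm.mul_apply, pairSwap_apply]
        simpa using hgb
    intro P Q
    obtain ⟨g, hg, rfl⟩ := hbase P
    obtain ⟨k, hk, rfl⟩ := hbase Q
    exact ⟨k * g⁻¹, mul_mem hk (inv_mem hg), by simp⟩

theorem eq_translate_of_regular (f : Vec → Vec) (h : ∀ i, f (f i) = i)
    (h' : ∀ i k, f i = i → f k = k) (i : Vec) : f i = vadd i (f (false, false)) := by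
  have key : ∀ f₀ f₁ f₂ f₃ : Vec,
      let f : Vec → Vec := fun i => cond i.1 (cond i.2 f₃ f₂) (cond i.2 f₁ f₀)
      (∀ i, f (f i) = i) → (∀ i k, f i = i → f k = k) → ∀ i, f i = vadd i (f (false, false)) := by
    decide +kernel
  have hf : f = fun i : Vec => cond i.1 (cond i.2 (f (true, true)) (f (true, false)))
      (cond i.2 (f (false, true)) (f (false, false))) := by
    funext ⟨a, b⟩
    cases a <;> cases b <;> rfl
  have := key (f (false, false)) (f (false, true)) (f (true, false)) (f (true, true))
  rw [← hf] at this
  exact this h h' i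

theorem even_of_compat (v w : Vec → Bool) (p q j : Vec) (hq : q ≠ (false, false)) (hqp : q ≠ p)
    (h : ∀ i, (w i ^^ decide (vadd i q = j) ^^ v (vadd i q) ^^ decide (vadd (vadd i q) p = j)) =
      (decide (i = j) ^^ v i ^^ decide (vadd i p = j) ^^ w (vadd i p))) :
    (v (false, false) ^^ v (false, true) ^^ v (true, false) ^^ v (true, true)) = false := by
  have key : ∀ p q j : Vec, q ≠ (false, false) → q ≠ p → ∀ v₀ v₁ v₂ v₃ w₀ w₁ w₂ w₃ : Bool,
      let v : Vec → Bool := fun i => cond i.1 (cond i.2 v₃ v₂) (cond i.2 v₁ v₀)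
      let w : Vec → Bool := fun i => cond i.1 (cond i.2 w₃ w₂) (cond i.2 w₁ w₀)
      (∀ i, (w i ^^ decide (vadd i q = j) ^^ v (vadd i q) ^^ decide (vadd (vadd i q) p = j)) =
        (decide (i = j) ^^ v i ^^ decide (vadd i p = j) ^^ w (vadd i p))) →
      (v (false, false) ^^ v (false, true) ^^ v (true, false) ^^ v (true, true)) = false := by
    decide +kernel
  have hf : ∀ v : Vec → Bool, v = fun i : Vec =>
      cond i.1 (cond i.2 (v (true, true)) (v (true, false)))
      (cond i.2 (v (false, true)) (v (false, false))) := by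
    intro v
    funext ⟨a, b⟩
    cases a <;> cases b <;> rfl
  have := key p q j hq hqp (v (false, false)) (v (false, true)) (v (true, false)) (v (true, true))
    (w (false, false)) (w (false, true)) (w (true, false)) (w (true, true))
  rw [← hf v, ← hf w] at this
  exact this h

theorem eq_aff_of_even (v : Vec → Bool)
    (h : (v (false, false) ^^ v (false, true) ^^ v (true, false) ^^ v (true, true)) = false)
    (i : Vec) :
    v i = (dotp (v (false, false) ^^ v (true, false), v (false, false) ^^ v (false, true)) i ^^
      v (false, false)) := by
  obtain ⟨a, b⟩ := i
  revert h
  cases a <;> cases b <;> cases v (false, false) <;> cases v (false, true) <;>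
    cases v (true, false) <;> cases v (true, true) <;> decide

theorem aff_injective (u v : Vec × Vec) (c d : Bool) (h : aff u c = aff v d) : u = v ∧ c = d := by
  have h' : ∀ P, aff u c P = aff v d P := fun P => by rw [h]
  clear h
  simp only [aff_apply] at h'
  revert u v c d
  decide +kernel

theorem pairSwap_injective : Function.Injective pairSwap := by
  intro j k h
  have h' : ∀ P, pairSwap j P = pairSwap k P := fun P => by rw [h]
  clear h
  simp only [pairSwap_apply] at h'
  revert j k
  decide +kernel

theorem exists_eq_pairSwap {s : Perm Pt} {x : Fin 4 → Perm Pt} (hs : s.IsSwap)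
    (hz : IsFlip s x flip) : ∃ j, s = pairSwap j := by
  obtain ⟨⟨i, b⟩, d, hcd, rfl⟩ := hs
  have h := hz.apply_left hcd
  refine ⟨i, ?_⟩
  rw [← h, pairSwap, flip_apply]
  cases b
  · rfl
  · exact swap_comm _ _

section Derivation

variable {j : Vec} {x : Fin 4 → Perm Pt}

theorem commute_flip_of_mem (hz : IsFlip (pairSwap j) x flip) {g : Perm Pt}
    (hg : g ∈ Subgroup.closure (Set.range x)) : Commute flip g := by
  induction hg using Subgroup.closure_induction with
  | mem y hy =>
    obtain ⟨i, rfl⟩ := hy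
    exact hz.comm_x i
  | one => exact Commute.one_right _
  | mul _ _ _ _ h₁ h₂ => exact h₁.mul_right h₂
  | inv _ _ h₁ => exact h₁.inv_right

theorem fst_eq_of_commute_flip {g : Perm Pt} (hg : Commute flip g) {P Q : Pt} (hPQ : P.1 = Q.1) :
    (g P).1 = (g Q).1 := by
  rw [apply_eq_of_commute_flip hg P, apply_eq_of_commute_flip hg Q, hPQ]

theorem exists_mem_fst_eq (h : IsRep (pairSwap j) x)
    (hz : IsFlip (pairSwap j) x flip) (i k : Vec) :
    ∃ g ∈ Subgroup.closure (Set.range x), (g (i, false)).1 = k := by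
  obtain ⟨g, hg, hgP⟩ := h.trans (i, false) (k, false)
  suffices ∃ g' ∈ Subgroup.closure (Set.range x), ∀ P, (g P).1 = (g' P).1 by
    obtain ⟨g', hg', h'⟩ := this
    exact ⟨g', hg', by rw [← h', hgP]⟩
  clear hgP
  induction hg using Subgroup.closure_induction with
  | mem y hy =>
    rcases hy with rfl | hy
    · exact ⟨1, one_mem _, fun P => by simp [pairSwap_apply]⟩
    · exact ⟨y, Subgroup.subset_closure hy, fun P => rfl⟩
  | one => exact ⟨1, one_mem _, fun P => rfl⟩
  | mul a b _ _ ha hb =>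
    obtain ⟨a', ha', ha⟩ := ha
    obtain ⟨b', hb', hb⟩ := hb
    refine ⟨a' * b', mul_mem ha' hb', fun P => ?_⟩
    rw [Perm.mul_apply, Perm.mul_apply, ha]
    exact fst_eq_of_commute_flip (commute_flip_of_mem hz ha') (hb P)
  | inv a _ ha =>
    obtain ⟨a', ha', ha⟩ := ha
    refine ⟨a'⁻¹, inv_mem ha', fun P => ?_⟩
    have h1 := fst_eq_of_commute_flip (commute_flip_of_mem hz (inv_mem ha'))
      (ha (a⁻¹ P)).symm
    simpa using h1

theorem fst_eq_vadd (h : IsRep (pairSwap j) x)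
    (hz : IsFlip (pairSwap j) x flip) {g : Perm Pt}
    (hg : g ∈ Subgroup.closure (Set.range x)) (P : Pt) :
    (g P).1 = vadd P.1 (g ((false, false), false)).1 := by
  have hfl : ∀ {k}, k ∈ Subgroup.closure (Set.range x) → Commute flip k :=
    fun hk => commute_flip_of_mem hz hk
  have hcomm : ∀ a ∈ Subgroup.closure (Set.range x), ∀ b ∈ Subgroup.closure (Set.range x), ∀ P,
      (a (b P)).1 = (b (a P)).1 := by
    intro a ha b hb P
    have h1 := Equiv.congr_fun (h.comm_of_mem ha hb).eq P
    simp only [Perm.mul_apply] at h1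
    have h2 := congrArg Prod.fst h1
    rw [pairSwap_apply] at h2
    rw [fst_eq_of_commute_flip (hfl ha) (Q := pairSwap j (b P)) (by rw [pairSwap_apply]), h2]
    refine fst_eq_of_commute_flip (hfl hb) ?_
    rw [pairSwap_apply]
    exact fst_eq_of_commute_flip (hfl ha) (by rw [pairSwap_apply])
  have hbase : (g (g (j, false))).1 = j := by
    by_cases hj : (g (j, false)).1 = j
    · rw [fst_eq_of_commute_flip (hfl hg) (Q := (j, false)) hj, hj]
    · by_contra hjj
      have h1 := Equiv.congr_fun (h.comm_of_mem hg hg).eq (j, false)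
      have h0 : pairSwap j (g (j, false)) = g (j, false) := by simp [pairSwap_apply, hj]
      have h2 : pairSwap j (g (g (j, false))) = g (g (j, false)) := by simp [pairSwap_apply, hjj]
      have h3 : pairSwap j (g (j, true)) = g (j, true) := by
        have : (g (j, true)).1 ≠ j := by
          rwa [fst_eq_of_commute_flip (hfl hg) (P := (j, true)) (Q := (j, false)) rfl]
        simp [pairSwap_apply, this]
      have h4 : pairSwap j (j, false) = (j, true) := by simp [pairSwap_apply]
      simp only [Perm.mul_apply, h0, h2, h4, h3] at h1
      simpa using g.injective (g.injective h1)
  have hinv : ∀ i, (g (g (i, false))).1 = i := by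
    intro i
    obtain ⟨k, hk, hki⟩ := exists_mem_fst_eq h hz j i
    have h1 : ∀ P Q : Pt, P.1 = Q.1 → (g (g P)).1 = (g (g Q)).1 := fun P Q hPQ =>
      fst_eq_of_commute_flip (hfl hg) (fst_eq_of_commute_flip (hfl hg) hPQ)
    rw [h1 _ (k (j, false)) hki.symm,
      fst_eq_of_commute_flip (hfl hg) (hcomm g hg k hk (j, false)), hcomm g hg k hk,
      fst_eq_of_commute_flip (hfl hk) (Q := (j, false)) hbase, hki]
  have hfix : ∀ i i', (g (i, false)).1 = i → (g (i', false)).1 = i' := by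
    intro i i' hi
    obtain ⟨k, hk, hki⟩ := exists_mem_fst_eq h hz i i'
    rw [fst_eq_of_commute_flip (hfl hg) (Q := k (i, false)) hki.symm, hcomm g hg k hk,
      fst_eq_of_commute_flip (hfl hk) (Q := (i, false)) hi, hki]
  rw [fst_eq_of_commute_flip (hfl hg) (P := P) (Q := (P.1, false)) rfl]
  refine eq_translate_of_regular (fun i => (g (i, false)).1) (fun i => ?_) hfix P.1
  exact (fst_eq_of_commute_flip (hfl hg) (P := ((g (i, false)).1, false)) (Q := g (i, false))
    rfl).trans (hinv i)

theorem exists_third (p : Vec) : ∃ q : Vec, q ≠ (false, false) ∧ q ≠ p := by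
  revert p
  decide

theorem exists_eq_aff (h : IsRep (pairSwap j) x)
    (hz : IsFlip (pairSwap j) x flip) {g : Perm Pt} (hg : g ∈ Subgroup.closure (Set.range x)) :
    ∃ u c, g = aff u c := by
  set p := (g ((false, false), false)).1 with hp
  obtain ⟨q, hq, hqp⟩ := exists_third p
  obtain ⟨k, hk, hkq⟩ := exists_mem_fst_eq h hz (false, false) q
  have form : ∀ {g}, g ∈ Subgroup.closure (Set.range x) → ∀ P : Pt,
      g P = (vadd P.1 (g ((false, false), false)).1, P.2 ^^ (g (P.1, false)).2) := by
    intro g hg P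
    rw [apply_eq_of_commute_flip (commute_flip_of_mem hz hg), fst_eq_vadd h hz hg]
  have hgf := form hg
  have hkf := form hk
  rw [← hp] at hgf
  rw [hkq] at hkf
  set v : Vec → Bool := fun i => (g (i, false)).2
  set w : Vec → Bool := fun i => (k (i, false)).2
  have hgf' : ∀ P : Pt, g P = (vadd P.1 p, P.2 ^^ v P.1) := hgf
  have hkf' : ∀ P : Pt, k P = (vadd P.1 q, P.2 ^^ w P.1) := hkf
  have heven := even_of_compat v w p q j hq hqp (by
    intro i
    have h1 := Equiv.congr_fun (h.comm_of_mem hg hk).eq (i, false)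
    simp only [Perm.mul_apply, pairSwap_apply, hgf', hkf'] at h1
    simpa only [Bool.false_xor] using congrArg Prod.snd h1)
  refine ⟨(p, (v (false, false) ^^ v (true, false), v (false, false) ^^ v (false, true))),
    v (false, false), ?_⟩
  ext1 P
  rw [hgf', aff_apply, eq_aff_of_even v heven P.1, Bool.xor_assoc]

theorem exists_symp (h : IsRep (pairSwap j) x)
    (hz : IsFlip (pairSwap j) x flip) {u : Fin 4 → Vec × Vec} {c : Fin 4 → Bool}
    (hx : ∀ i, x i = aff (u i) (c i)) :
    ∃ i i', symp (u i).1 (u i').1 = true := by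
  by_contra! hs
  simp only [ne_eq, Bool.not_eq_true] at hs
  have hline : ∀ p q : Vec, symp p q = false → p ≠ (false, false) → q = (false, false) ∨ q = p := by
    decide
  obtain ⟨r, hr⟩ : ∃ r, ∀ i, (u i).1 = (false, false) ∨ (u i).1 = r := by
    by_cases hi : ∃ i, (u i).1 ≠ (false, false)
    · obtain ⟨i, hi⟩ := hi
      exact ⟨(u i).1, fun i' => hline _ _ (hs i i') hi⟩
    · push Not at hi
      exact ⟨(false, false), fun i => Or.inl (hi i)⟩
  have hmem : ∀ g ∈ Subgroup.closure (Set.range x), ∃ p, (p = (false, false) ∨ p = r) ∧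
      ∀ P, (g P).1 = vadd P.1 p := by
    intro g hg
    induction hg using Subgroup.closure_induction with
    | mem y hy =>
      obtain ⟨i, rfl⟩ := hy
      exact ⟨_, hr i, fun P => by rw [hx, aff_apply]⟩
    | one => exact ⟨(false, false), Or.inl rfl, fun P => by simp [vadd]⟩
    | mul a b _ _ ha hb =>
      obtain ⟨p, hp, ha⟩ := ha
      obtain ⟨q, hq, hb⟩ := hb
      refine ⟨vadd q p, ?_, fun P => ?_⟩
      · rcases hp with rfl | rfl <;> rcases hq with rfl | rfl <;> simp [vadd]
      · rw [Perm.mul_apply, ha, hb]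
        simp [vadd]
    | inv a _ ha =>
      obtain ⟨p, hp, ha⟩ := ha
      refine ⟨p, hp, fun P => ?_⟩
      have h1 := ha (a⁻¹ P)
      rw [show a (a⁻¹ P) = P by simp] at h1
      rw [h1]
      simp [vadd]
  obtain ⟨q, hq, hqr⟩ := exists_third r
  obtain ⟨g, hg, hgq⟩ := exists_mem_fst_eq h hz (false, false) q
  obtain ⟨p, hp, hgp⟩ := hmem g hg
  rw [hgp] at hgq
  simp only [vadd, Bool.false_xor] at hgq
  rcases hp with rfl | rfl
  · exact hq hgq.symm
  · exact hqr hgq.symm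

end Derivation

theorem exists_good {s : Perm Pt} {x : Fin 4 → Perm Pt} (h : IsRep s x) (hz : IsFlip s x flip) :
    ∃ (j : Vec) (u : Fin 4 → Vec × Vec) (c : Fin 4 → Bool),
    Good u ∧ s = pairSwap j ∧ x = fun i => aff (u i) (c i) := by
  obtain ⟨j, rfl⟩ := exists_eq_pairSwap h.isSwap hz
  choose u c hx using fun i =>
    exists_eq_aff h hz (Subgroup.subset_closure (Set.mem_range_self i))
  have hcompat : ∀ i i', Compat (u i) (u i') := fun i i' =>
    (commute_aff_iff j _ _ (c i) (c i')).1 (by rw [← hx, ← hx]; exact h.comm i i')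
  refine ⟨j, u, c, ⟨hcompat, ?_, exists_symp h hz hx⟩, rfl, funext hx⟩
  have h1 := h.surface
  rw [hx, hx, hx, hx, commutator_aff, commutator_aff, aff_zero_mul_eq_one_iff] at h1
  rw [← hcompat 0 2, ← hcompat 1 3, h1]

instance (u : Fin 4 → Vec × Vec) : Decidable (Good u) :=
  decidable_of_iff ((∀ i j, Compat (u i) (u j)) ∧ symp (u 0).1 (u 2).1 = symp (u 1).1 (u 3).1 ∧
    ∃ i j, symp (u i).1 (u j).1 = true) ⟨fun h => ⟨h.1, h.2.1, h.2.2⟩, fun h => ⟨h.1, h.2, h.3⟩⟩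

theorem sum_quadruple_ite {A : Type*} [Fintype A] (p : A → A → Prop) (q : A → A → A → Prop)
    (r : A → A → A → A → Prop) [∀ a b, Decidable (p a b)] [∀ a b c, Decidable (q a b c)]
    [∀ a b c d, Decidable (r a b c d)] :
    (∑ t : A × A × A × A, if p t.1 t.2.1 ∧ q t.1 t.2.1 t.2.2.1 ∧ r t.1 t.2.1 t.2.2.1 t.2.2.2
      then 1 else 0) = ∑ a, ∑ b, if p a b then ∑ c, if q a b c then
        ∑ d, if r a b c d then 1 else 0 else 0 else 0 := by
  simp only [Fintype.sum_prod_type, ite_and, Finset.sum_ite_irrel, Finset.sum_const_zero]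

theorem symp_comm : ∀ p q, symp p q = symp q p := by decide

theorem symp_self : ∀ p, symp p p = false := by decide

theorem card_good : Fintype.card {u : Fin 4 → Vec × Vec // Good u} = 720 := by
  have hgood : ∀ a b c d : Vec × Vec, Good ![a, b, c, d] ↔ Compat a b ∧
      (Compat a c ∧ Compat b c) ∧ (Compat a d ∧ Compat b d ∧ Compat c d) ∧
      symp a.1 c.1 = symp b.1 d.1 ∧ (symp a.1 b.1 || symp a.1 c.1 || symp a.1 d.1 || symp b.1 c.1 ||
        symp b.1 d.1 || symp c.1 d.1) = true := by
    intro a b c d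
    constructor
    · rintro ⟨h, h', h''⟩
      refine ⟨h 0 1, ⟨h 0 2, h 1 2⟩, ⟨h 0 3, h 1 3, h 2 3⟩, h', ?_⟩
      simp [Fin.exists_fin_succ, symp_self, symp_comm b.1 a.1, symp_comm c.1 a.1,
        symp_comm c.1 b.1, symp_comm d.1 a.1, symp_comm d.1 b.1, symp_comm d.1 c.1] at h''
      simp only [Bool.or_eq_true]
      tauto
    · rintro ⟨h01, ⟨h02, h12⟩, ⟨h03, h13, h23⟩, h', h''⟩
      refine ⟨?_, h', ?_⟩
      · simp [Fin.forall_fin_succ, compat_self, compat_comm, *]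
      · simp only [Bool.or_eq_true] at h''
        rcases h'' with ((((h | h) | h) | h) | h) | h
        exacts [⟨0, 1, h⟩, ⟨0, 2, h⟩, ⟨0, 3, h⟩, ⟨1, 2, h⟩, ⟨1, 3, h⟩, ⟨2, 3, h⟩]
  let e : (Vec × Vec) × (Vec × Vec) × (Vec × Vec) × (Vec × Vec) ≃ (Fin 4 → Vec × Vec) :=
    { toFun := fun t => ![t.1, t.2.1, t.2.2.1, t.2.2.2]
      invFun := fun u => (u 0, u 1, u 2, u 3)
      left_inv := fun t => rfl
      right_inv := fun u => by
        ext1 i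
        fin_cases i <;> rfl }
  rw [Fintype.card_subtype, Finset.card_filter, ← e.sum_comp]
  refine (Finset.sum_congr rfl fun t _ =>
    if_congr (hgood t.1 t.2.1 t.2.2.1 t.2.2.2) rfl rfl).trans ?_
  refine (sum_quadruple_ite (fun a b : Vec × Vec => Compat a b)
    (fun a b c => Compat a c ∧ Compat b c)
    (fun a b c d => (Compat a d ∧ Compat b d ∧ Compat c d) ∧ symp a.1 c.1 = symp b.1 d.1 ∧
      (symp a.1 b.1 || symp a.1 c.1 || symp a.1 d.1 || symp b.1 c.1 ||
        symp b.1 d.1 || symp c.1 d.1) = true)).trans ?_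
  decide +kernel

end Model

section Count

theorem ncard_eq_card_mul_of_fibres {A D : Type*} [Finite A] {S : Set A} {U : Finset D} {m : ℕ}
    (f : A → D) (hf : ∀ a ∈ S, f a ∈ U) (hm : ∀ d ∈ U, {a | a ∈ S ∧ f a = d}.ncard = m) :
    S.ncard = U.card * m := by
  classical
  have := Fintype.ofFinite A
  rw [Set.ncard_eq_toFinset_card', Finset.card_eq_sum_card_fiberwise (t := U) (f := f)
    (fun a ha => hf a (by simpa using ha))]
  refine Finset.sum_const_nat fun d hd => ?_
  rw [← hm d hd, Set.ncard_eq_toFinset_card']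
  congr 1
  ext a
  simp

theorem ncard_isFlip_flip :
    {t : Perm Pt × (Fin 4 → Perm Pt) | IsRep t.1 t.2 ∧ IsFlip t.1 t.2 flip}.ncard = 46080 := by
  let f : Vec × {u // Good u} × (Fin 4 → Bool) → Perm Pt × (Fin 4 → Perm Pt) :=
    fun p => (pairSwap p.1, fun i => aff (p.2.1.1 i) (p.2.2 i))
  have hf : Function.Injective f := by
    rintro ⟨j, ⟨u, hu⟩, c⟩ ⟨k, ⟨v, hv⟩, d⟩ h
    obtain ⟨h1, h2⟩ := Prod.ext_iff.1 h
    have h3 := fun i => aff_injective _ _ _ _ (congrFun h2 i)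
    obtain rfl : j = k := pairSwap_injective h1
    obtain rfl : u = v := funext fun i => (h3 i).1
    obtain rfl : c = d := funext fun i => (h3 i).2
    rfl
  have hrange : {t : Perm Pt × (Fin 4 → Perm Pt) | IsRep t.1 t.2 ∧ IsFlip t.1 t.2 flip} =
      Set.range f := by
    ext ⟨s, x⟩
    constructor
    · rintro ⟨h, hz⟩
      obtain ⟨j, u, c, hu, hs, hx⟩ := exists_good h hz
      exact ⟨(j, ⟨u, hu⟩, c), Prod.ext hs.symm hx.symm⟩
    · rintro ⟨⟨j, u, c⟩, h⟩
      rw [← h]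
      exact ⟨u.2.isRep c j, isFlip_aff c j⟩
  rw [hrange, Set.ncard_range_of_injective hf, Nat.card_eq_fintype_card, Fintype.card_prod,
    Fintype.card_prod {u // Good u}, card_good]
  simp

theorem flip_cycleType : flip.cycleType = {2, 2, 2, 2} :=
  (isFlip_aff (u := fun _ => ((false, false), (false, false))) (fun _ => false)
    (false, false)).cycleType rfl

theorem ncard_isFlip {z : Perm Pt} (hz : z.cycleType = {2, 2, 2, 2}) :
    {t : Perm Pt × (Fin 4 → Perm Pt) | IsRep t.1 t.2 ∧ IsFlip t.1 t.2 z}.ncard = 46080 := by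
  obtain ⟨g, rfl⟩ := isConj_iff.1 (isConj_of_cycleType_eq (flip_cycleType.trans hz.symm))
  rw [← ncard_isFlip_flip]
  symm
  refine Set.ncard_congr (fun t _ => (MulAut.conj g t.1, fun i => MulAut.conj g (t.2 i)))
    (fun t ht => ⟨ht.1.conj g, ht.2.conj g⟩) ?_ ?_
  · rintro ⟨s, x⟩ ⟨s', x'⟩ - - h
    obtain ⟨h1, h2⟩ := Prod.ext_iff.1 h
    exact Prod.ext ((MulAut.conj g).injective h1)
      (funext fun i => (MulAut.conj g).injective (congrFun h2 i))
  · rintro ⟨s, x⟩ ⟨h, hz⟩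
    refine ⟨(MulAut.conj g⁻¹ s, fun i => MulAut.conj g⁻¹ (x i)), ⟨h.conj g⁻¹, ?_⟩, ?_⟩
    · have h1 := hz.conj g⁻¹
      rwa [show MulAut.conj g⁻¹ (g * flip * g⁻¹) = flip by simp [mul_assoc]] at h1
    · ext1
      · simp [mul_assoc]
      · funext i
        simp [mul_assoc]

theorem card_cycleType_pairs :
    (Finset.univ.filter fun z : Perm Pt => z.cycleType = {2, 2, 2, 2}).card = 105 := by
  rw [card_of_cycleType, if_pos]
  · simp
    decide +kernel
  · simp

theorem ncard_isRep :
    {t : Perm Pt × (Fin 4 → Perm Pt) | IsRep t.1 t.2}.ncard = 4838400 := by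
  choose! z hz using fun (t : Perm Pt × (Fin 4 → Perm Pt)) (ht : IsRep t.1 t.2) =>
    ht.exists_isFlip (by decide)
  rw [ncard_eq_card_mul_of_fibres (m := 46080) z
    (U := Finset.univ.filter fun z : Perm Pt => z.cycleType = {2, 2, 2, 2}), card_cycleType_pairs]
  · exact fun t ht => Finset.mem_filter.2 ⟨Finset.mem_univ _, (hz t ht).cycleType rfl⟩
  · intro w hw
    rw [← ncard_isFlip (Finset.mem_filter.1 hw).2]
    congr 1
    ext t
    exact and_congr_right fun ht => ⟨fun h => h ▸ hz t ht, fun h => (hz t ht).unique ht h⟩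

end Count

section Homs

/-- The four generators of `B` other than `σ`. -/
def gen : Fin 4 → Gen := ![Gen.a1, Gen.a2, Gen.b1, Gen.b2]

/-- The map sending `gen i` to `x i` and the generator `σ` to `s`. -/
def genMap {α : Type*} (s : α) (x : Fin 4 → α) : Gen → α
  | Gen.a1 => x 0
  | Gen.a2 => x 1
  | Gen.b1 => x 2
  | Gen.b2 => x 3
  | Gen.s => s

theorem exists_genMap {α : Type*} (f : Gen → α) : f = genMap (f Gen.s) (fun i => f (gen i)) := by
  funext k
  cases k <;> rfl

theorem range_genMap {α : Type*} (s : α) (x : Fin 4 → α) :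
    Set.range (genMap s x) = insert s (Set.range x) := by
  ext y
  constructor
  · rintro ⟨k, rfl⟩
    cases k
    exacts [Or.inr ⟨0, rfl⟩, Or.inr ⟨1, rfl⟩, Or.inr ⟨2, rfl⟩, Or.inr ⟨3, rfl⟩, Or.inl rfl]
  · rintro (rfl | ⟨i, rfl⟩)
    · exact ⟨Gen.s, rfl⟩
    · fin_cases i
      exacts [⟨Gen.a1, rfl⟩, ⟨Gen.a2, rfl⟩, ⟨Gen.b1, rfl⟩, ⟨Gen.b2, rfl⟩]

theorem lift_rels_iff {G : Type*} [Group G] {s : G} {x : Fin 4 → G} (hs : s * s = 1) :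
    (∀ r ∈ rels, FreeGroup.lift (genMap s x) r = 1) ↔ (∀ i j, Commute (s * x i * s) (x j)) ∧
      x 0 * (x 2)⁻¹ * (x 0)⁻¹ * x 2 * (x 1 * (x 3)⁻¹ * (x 1)⁻¹ * x 3) = 1 := by
  have hs' : s⁻¹ = s := inv_eq_of_mul_eq_one_right hs
  have hswap : ∀ i j, Commute (s * x i * s) (x j) ↔ Commute (s * x j * s) (x i) := by
    have key : ∀ i j, Commute (s * x i * s) (x j) → Commute (s * x j * s) (x i) := by
      intro i j h
      have h1 := h.map (MulAut.conj s).toMonoidHom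
      have h2 : s * (s * x i * s) * s = x i := by
        calc s * (s * x i * s) * s = s * s * x i * (s * s) := by group
          _ = x i := by simp [hs]
      simp only [MulEquiv.toMonoidHom_eq_coe, MonoidHom.coe_coe, MulAut.conj_apply, hs', h2] at h1
      exact h1.symm
    exact fun i j => ⟨key i j, key j i⟩
  have hrel : ∀ i j, s * x i * s * x j * (s⁻¹ * (x i)⁻¹ * s⁻¹ * (x j)⁻¹) = 1 ↔
      Commute (s * x i * s) (x j) := by
    intro i j
    rw [commute_iff_eq, ← mul_inv_eq_one (b := x j * (s * x i * s))]
    simp only [mul_inv_rev, mul_assoc]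
  simp only [commute_iff_eq] at hswap hrel ⊢
  simp only [rels, Set.mem_insert_iff, Set.mem_singleton_iff, forall_eq_or_imp, forall_eq,
    map_mul, map_inv, FreeGroup.lift_apply_of, genMap, hs', hs, inv_one, mul_one, mul_inv_eq_one]
  constructor
  · rintro ⟨h00, h11, h22, h33, h01, h23, h03, h21, h02, h13, h⟩
    simp only [← mul_assoc] at h00 h11 h22 h33 h01 h23 h03 h21 h02 h13 hswap ⊢
    refine ⟨?_, by simpa only [← mul_assoc] using h⟩
    intro i j
    have := hswap i j
    fin_cases i <;> fin_cases j <;>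
      simp only [Fin.reduceFinMk, Fin.zero_eta, Fin.mk_one] at this ⊢ <;>
      first | assumption | (rw [this]; assumption)
  · rintro ⟨h, h'⟩
    simp only [← mul_assoc] at h h' ⊢
    exact ⟨h 0 0, h 1 1, h 2 2, h 3 3, h 0 1, h 2 3, h 0 3, h 2 1, h 0 2, h 1 3, h'⟩

theorem isGeneric_iff {n : ℕ} (φ : B →* Perm (Fin n)) :
    IsGeneric n φ ↔ IsRep (φ σB) (fun i => φ (PresentedGroup.of (gen i))) := by
  set f : Gen → Perm (Fin n) := fun k => φ (PresentedGroup.of k) with hf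
  set x : Fin 4 → Perm (Fin n) := fun i => φ (PresentedGroup.of (gen i)) with hx
  have hfx : f = genMap (φ σB) x := exists_genMap f
  have hrange : φ.range = Subgroup.closure (insert (φ σB) (Set.range x)) := by
    rw [← range_genMap, ← hfx, MonoidHom.range_eq_map, ← PresentedGroup.closure_range_of,
      MonoidHom.map_closure, ← Set.range_comp]
    rfl
  have htrans : (∀ P Q, ∃ g, φ g P = Q) ↔
      ∀ P Q, ∃ g ∈ Subgroup.closure (insert (φ σB) (Set.range x)), g P = Q := by
    rw [← hrange]
    simp
  have hrel : ∀ r ∈ rels, FreeGroup.lift (genMap (φ σB) x) r = 1 := by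
    intro r hr
    have h1 : FreeGroup.lift (genMap (φ σB) x) = φ.comp (PresentedGroup.mk rels) := by
      rw [← hfx]
      ext1 k
      rw [FreeGroup.lift_apply_of]
      rfl
    rw [h1, MonoidHom.comp_apply, (PresentedGroup.mk_eq_one_iff).2
      (Subgroup.subset_normalClosure hr), map_one]
  constructor
  · rintro ⟨h1, h2⟩
    have hs : φ σB * φ σB = 1 := by
      obtain ⟨c, d, -, h⟩ := h1
      rw [h, swap_mul_self]
    obtain ⟨h3, h4⟩ := (lift_rels_iff hs).1 hrel
    exact ⟨h1, h3, h4, htrans.1 h2⟩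
  · intro h
    exact ⟨h.isSwap, htrans.2 h.trans⟩

theorem ncard_isGeneric (n : ℕ) : {φ : B →* Perm (Fin n) | IsGeneric n φ}.ncard =
    {t : Perm (Fin n) × (Fin 4 → Perm (Fin n)) | IsRep t.1 t.2}.ncard := by
  refine Set.ncard_congr (fun φ _ => (φ σB, fun i => φ (PresentedGroup.of (gen i))))
    (fun φ hφ => (isGeneric_iff φ).1 hφ) ?_ ?_
  · intro φ ψ _ _ h
    obtain ⟨h1, h2⟩ := Prod.ext_iff.1 h
    refine PresentedGroup.ext fun k => ?_
    cases k
    exacts [congrFun h2 0, congrFun h2 1, congrFun h2 2, congrFun h2 3, h1]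
  · rintro ⟨s, x⟩ (h : IsRep s x)
    have hrel := (lift_rels_iff h.mul_self).2 ⟨h.comm, h.surface⟩
    have hs : PresentedGroup.toGroup hrel σB = s := PresentedGroup.toGroup.of hrel
    have hx : (fun i => PresentedGroup.toGroup hrel (PresentedGroup.of (gen i))) = x := by
      funext i
      rw [PresentedGroup.toGroup.of hrel]
      fin_cases i <;> rfl
    refine ⟨PresentedGroup.toGroup hrel, (isGeneric_iff _).2 ?_, Prod.ext hs hx⟩
    rw [hs, hx]
    exact h

theorem ncard_isRep_congr {α β : Type*} [DecidableEq α] [DecidableEq β] (e : α ≃ β) :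
    {t : Perm α × (Fin 4 → Perm α) | IsRep t.1 t.2}.ncard =
      {t : Perm β × (Fin 4 → Perm β) | IsRep t.1 t.2}.ncard := by
  refine Set.ncard_congr (fun t _ => (e.permCongrHom t.1, fun i => e.permCongrHom (t.2 i)))
    (fun t ht => IsRep.permCongr e ht) ?_ ?_
  · rintro ⟨s, x⟩ ⟨s', x'⟩ - - h
    obtain ⟨h1, h2⟩ := Prod.ext_iff.1 h
    exact Prod.ext (e.permCongrHom.injective h1)
      (funext fun i => e.permCongrHom.injective (congrFun h2 i))
  · rintro ⟨s, x⟩ h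
    exact ⟨(e.symm.permCongrHom s, fun i => e.symm.permCongrHom (x i)), h.permCongr e.symm,
      Prod.ext (by ext P; simp) (by funext i; ext P; simp)⟩

end Homs

end SurfaceBraid

/-- There are exactly 4838400 generic monodromy representations of B in S₈. -/
theorem stmt12 :
    Set.ncard {φ : B →* Equiv.Perm (Fin 8) | IsGeneric 8 φ} = 4838400 := by
  rw [SurfaceBraid.ncard_isGeneric, SurfaceBraid.ncard_isRep_congr
    (Fintype.equivOfCardEq (by simp) : Fin 8 ≃ SurfaceBraid.Pt), SurfaceBraid.ncard_isRep]
end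

section
/- There are exactly 480 group homomorphisms φ: B → S₄ such that φ(σ) is the fixed transposition (1 2), and the image of φ is a transitive subgroup of S₄. -/
open Braid

open Equiv Finset
open scoped Pointwise

/-- The relations (R2) and (R4) satisfied by the images `s` of `σ` and `p = (a, b)` of the
generators coming from one handle. -/
def HandleRel {G : Type*} [Mul G] [Inv G] (s : G) (p : G × G) : Prop :=
  s⁻¹ * p.1 * s⁻¹ * p.1 = p.1 * s⁻¹ * p.1 * s⁻¹ ∧
  s⁻¹ * p.2 * s⁻¹ * p.2 = p.2 * s⁻¹ * p.2 * s⁻¹ ∧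
  s⁻¹ * p.1 * s⁻¹ * p.2 = p.2 * s⁻¹ * p.1 * s

/-- The relations (R3) and (TR) between the generators coming from the two handles. -/
def LinkRel {G : Type*} [Mul G] [Inv G] (s : G) (p q : G × G) : Prop :=
  s⁻¹ * p.1 * s * q.1 = q.1 * s⁻¹ * p.1 * s ∧
  s⁻¹ * p.2 * s * q.2 = q.2 * s⁻¹ * p.2 * s ∧
  s⁻¹ * p.1 * s * q.2 = q.2 * s⁻¹ * p.1 * s ∧
  s⁻¹ * p.2 * s * q.1 = q.1 * s⁻¹ * p.2 * s ∧
  (p.1 * p.2⁻¹ * p.1⁻¹ * p.2) * (q.1 * q.2⁻¹ * q.1⁻¹ * q.2) = s * s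

/-- The images of the generators of `B` prescribed by `s`, `p` and `q`. -/
def genImage {G : Type*} (s : G) (p q : G × G) : Gen → G
  | .a1 => p.1
  | .b1 => p.2
  | .a2 => q.1
  | .b2 => q.2
  | .s => s

/-- The only nonempty set of points mapped into itself by `s` and by the components of `p` and
`q` is the whole type. -/
def NoInvariant {α : Type*} [Fintype α] (s : Perm α) (p q : Perm α × Perm α) : Prop :=
  ∀ S : Finset α, S.Nonempty → (∀ i ∈ S, s i ∈ S ∧ p.1 i ∈ S ∧ p.2 i ∈ S ∧ q.1 i ∈ S ∧ q.2 i ∈ S) →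
    S = univ

instance {G : Type*} [Mul G] [Inv G] [DecidableEq G] (s : G) : DecidablePred (HandleRel s) :=
  fun _ => by unfold HandleRel; infer_instance

instance {G : Type*} [Mul G] [Inv G] [DecidableEq G] (s : G) (p q : G × G) :
    Decidable (LinkRel s p q) := by unfold LinkRel; infer_instance

lemma handleRel_map_iff {G H : Type*} [Mul G] [Inv G] [Mul H] [Inv H] {f : G → H}
    (hf : f.Injective) (hmul : ∀ x y, f (x * y) = f x * f y) (hinv : ∀ x, f x⁻¹ = (f x)⁻¹)
    (s : G) (p : G × G) : HandleRel (f s) (p.map f f) ↔ HandleRel s p := by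
  simp only [HandleRel, Prod.map_fst, Prod.map_snd, ← hmul, ← hinv, hf.eq_iff]

lemma linkRel_map_iff {G H : Type*} [Mul G] [Inv G] [Mul H] [Inv H] {f : G → H}
    (hf : f.Injective) (hmul : ∀ x y, f (x * y) = f x * f y) (hinv : ∀ x, f x⁻¹ = (f x)⁻¹)
    (s : G) (p q : G × G) : LinkRel (f s) (p.map f f) (q.map f f) ↔ LinkRel s p q := by
  simp only [LinkRel, Prod.map_fst, Prod.map_snd, ← hmul, ← hinv, hf.eq_iff]

/-- The assignment `genImage s p q` satisfies the relations of `B` if and only if `HandleRel` and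
`LinkRel` hold. -/
lemma lift_rels_iff {G : Type*} [Group G] (s : G) (p q : G × G) :
    (∀ r ∈ rels, FreeGroup.lift (genImage s p q) r = 1) ↔
      HandleRel s p ∧ HandleRel s q ∧ LinkRel s p q := by
  simp only [rels, Set.mem_insert_iff, Set.mem_singleton_iff, forall_eq_or_imp, forall_eq,
    map_mul, map_inv, FreeGroup.lift_apply_of, genImage, mul_inv_eq_one, HandleRel, LinkRel,
    ← mul_assoc]
  tauto

/-- A homomorphism from `B` to permutations of a finite type is transitive if and only if no
proper nonempty set of points is invariant under the images of the generators. -/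
lemma transitive_iff_noInvariant {α : Type*} [Fintype α] (φ : B →* Perm α) :
    (∀ i j, ∃ g, φ g i = j) ↔
      NoInvariant (φ σB) (φ (.of .a1), φ (.of .b1)) (φ (.of .a2), φ (.of .b2)) := by
  classical
  constructor
  · rintro h S ⟨i, hi⟩ hS
    have key : (MulAction.stabilizer (Perm α) (S : Set α)).comap φ = ⊤ := by
      rw [eq_top_iff, ← PresentedGroup.closure_range_of, Subgroup.closure_le]
      rintro _ ⟨x, rfl⟩
      rw [SetLike.mem_coe, Subgroup.mem_comap,
        MulAction.mem_stabilizer_set_iff_smul_set_subset S.finite_toSet]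
      rintro _ ⟨j, hj, rfl⟩
      obtain ⟨hs, ha, hb, ha', hb'⟩ := hS j hj
      cases x <;> assumption
    refine eq_univ_of_forall fun j => ?_
    obtain ⟨g, rfl⟩ := h i j
    have hg : φ g ∈ MulAction.stabilizer (Perm α) (S : Set α) := by
      rw [← Subgroup.mem_comap, key]; trivial
    rw [MulAction.mem_stabilizer_set_iff_smul_set_subset S.finite_toSet] at hg
    exact hg ⟨i, hi, rfl⟩
  · intro h i j
    have hS := h {j | ∃ g, φ g i = j} ⟨i, by simpa using ⟨1, by simp⟩⟩ (by
      simp only [mem_filter_univ]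
      rintro _ ⟨g, rfl⟩
      simp only [← Perm.mul_apply, ← map_mul]
      exact ⟨⟨_, rfl⟩, ⟨_, rfl⟩, ⟨_, rfl⟩, ⟨_, rfl⟩, ⟨_, rfl⟩⟩)
    simpa using hS.ge (mem_univ j)

open Classical in
/-- The possible images of the generators other than `σ` under a transitive homomorphism from `B`
sending `σ` to `s`. -/
noncomputable def transitiveTuples {α : Type*} [Fintype α] (s : Perm α) :
    Finset ((Perm α × Perm α) × Perm α × Perm α) :=
  (univ.filter (HandleRel s) ×ˢ univ.filter (HandleRel s)).filter
    fun x => LinkRel s x.1 x.2 ∧ NoInvariant s x.1 x.2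

/-- A transitive homomorphism from `B` sending `σ` to `s` amounts to an element of
`transitiveTuples s`. -/
lemma bijOn_transitiveTuples {α : Type*} [Fintype α] (s : Perm α) :
    Set.BijOn (fun φ : B →* Perm α => ((φ (.of .a1), φ (.of .b1)), φ (.of .a2), φ (.of .b2)))
      {φ | φ σB = s ∧ ∀ i j, ∃ g, φ g i = j}
      (transitiveTuples s) := by
  refine ⟨?_, ?_, ?_⟩
  · rintro φ ⟨rfl, hφ⟩
    have hgen : genImage (φ σB) (φ (.of .a1), φ (.of .b1)) (φ (.of .a2), φ (.of .b2)) =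
        fun x => φ (.of x) := by ext x : 1; cases x <;> rfl
    have := (lift_rels_iff (φ σB) (φ (.of .a1), φ (.of .b1)) (φ (.of .a2), φ (.of .b2))).1
      fun r hr => by
        rw [hgen, ← map_one φ, ← PresentedGroup.one_of_mem hr]
        exact (FreeGroup.lift_unique (φ.comp (PresentedGroup.mk rels)) fun _ => rfl).symm
    simpa [transitiveTuples, and_assoc, this] using (transitive_iff_noInvariant φ).1 hφ
  · rintro φ ⟨hφ, -⟩ ψ ⟨hψ, -⟩ h
    simp only [Prod.mk.injEq] at h
    obtain ⟨⟨h1, h2⟩, h3, h4⟩ := h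
    ext x : 1
    cases x
    exacts [h1, h3, h2, h4, hφ.trans hψ.symm]
  · rintro ⟨p, q⟩ h
    simp only [transitiveTuples, coe_filter, mem_product, mem_filter_univ, Set.mem_ofPred_eq] at h
    refine ⟨PresentedGroup.toGroup ((lift_rels_iff s p q).2 ⟨h.1.1, h.1.2, h.2.1⟩), ⟨?_, ?_⟩, ?_⟩
    · exact PresentedGroup.toGroup.of _
    · rw [transitive_iff_noInvariant]
      simpa [σB, PresentedGroup.toGroup.of, genImage] using h.2.2
    · simp [PresentedGroup.toGroup.of, genImage]

/-- A permutation of `Fin 4` encoded as the number whose base `4` digits are its values, so that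
products and inverses are computed by arithmetic of numerals. -/
def PermCode : Type := ℕ

namespace PermCode

instance : DecidableEq PermCode := inferInstanceAs (DecidableEq ℕ)

/-- The value at `i` of the permutation with code `n`. -/
def digit (n : PermCode) (i : ℕ) : ℕ := Nat.mod (Nat.div n (Nat.pow 4 i)) 4

instance : Mul PermCode where
  mul m n := (digit m (digit n 0) + 4 * digit m (digit n 1) + 16 * digit m (digit n 2) +
    64 * digit m (digit n 3) : ℕ)

instance : Inv PermCode where
  inv n := (Nat.pow 4 (digit n 1) + 2 * Nat.pow 4 (digit n 2) + 3 * Nat.pow 4 (digit n 3) : ℕ)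

/-- The code of a permutation. -/
def ofPerm (x : Perm (Fin 4)) : PermCode :=
  ((x 0).val + 4 * (x 1).val + 16 * (x 2).val + 64 * (x 3).val : ℕ)

lemma digit_ofPerm (x : Perm (Fin 4)) (i : Fin 4) : digit (ofPerm x) i = x i := by
  change ((x 0).val + 4 * (x 1).val + 16 * (x 2).val + 64 * (x 3).val) / 4 ^ i.val % 4 = x i
  fin_cases i <;> simp <;> omega

lemma ofPerm_injective : Function.Injective ofPerm := fun x y h => by
  ext i
  rw [← digit_ofPerm, h, digit_ofPerm]

lemma ofPerm_mul (x y : Perm (Fin 4)) : ofPerm (x * y) = ofPerm x * ofPerm y := by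
  have h (i : Fin 4) : digit (ofPerm x) (digit (ofPerm y) i) = x (y i) := by
    rw [digit_ofPerm, digit_ofPerm]
  change _ = digit (ofPerm x) (digit (ofPerm y) (0 : Fin 4)) +
    4 * digit (ofPerm x) (digit (ofPerm y) (1 : Fin 4)) +
    16 * digit (ofPerm x) (digit (ofPerm y) (2 : Fin 4)) +
    64 * digit (ofPerm x) (digit (ofPerm y) (3 : Fin 4))
  rw [h, h, h, h]
  rfl

lemma ofPerm_inv (x : Perm (Fin 4)) : ofPerm x⁻¹ = (ofPerm x)⁻¹ := by
  have h := Equiv.sum_comp x fun i => (x⁻¹ i).val * 4 ^ i.val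
  simp only [Fin.sum_univ_four, Perm.inv_def, symm_apply_apply, ← digit_ofPerm x] at h
  change (x⁻¹ 0).val + 4 * (x⁻¹ 1).val + 16 * (x⁻¹ 2).val + 64 * (x⁻¹ 3).val =
    4 ^ digit (ofPerm x) 1 + 2 * 4 ^ digit (ofPerm x) 2 + 3 * 4 ^ digit (ofPerm x) 3
  simp [Perm.inv_def] at h ⊢
  omega

/-- The set of points whose indicator bits are those of `m` is mapped into itself by the
permutation with code `n`. -/
def Preserves (m : ℕ) (n : PermCode) : Prop :=
  ∀ i ∈ List.range 4, m.testBit i → m.testBit (digit n i)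

instance (m : ℕ) (n : PermCode) : Decidable (Preserves m n) := by
  unfold Preserves; infer_instance

lemma preserves_ofPerm {m : ℕ} {S : Finset (Fin 4)} (hm : ∀ i : Fin 4, m.testBit i ↔ i ∈ S)
    (x : Perm (Fin 4)) : Preserves m (ofPerm x) ↔ ∀ i ∈ S, x i ∈ S := by
  simp only [Preserves, List.mem_range, ← hm, ← digit_ofPerm]
  exact (Fin.forall_iff (p := fun i : Fin 4 => m.testBit i → m.testBit (digit (ofPerm x) i))).symm

/-- The counterpart of `NoInvariant` for codes; the proper nonempty subsets of `Fin 4` are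
encoded by the numbers from `1` to `14`. -/
def NoPreserved (s : PermCode) (p q : PermCode × PermCode) : Prop :=
  ∀ m ∈ List.range' 1 14, ¬(Preserves m s ∧ Preserves m p.1 ∧ Preserves m p.2 ∧
    Preserves m q.1 ∧ Preserves m q.2)

instance (s : PermCode) (p q : PermCode × PermCode) : Decidable (NoPreserved s p q) := by
  unfold NoPreserved; infer_instance

lemma noPreserved_ofPerm (s : Perm (Fin 4)) (p q : Perm (Fin 4) × Perm (Fin 4)) :
    NoPreserved (ofPerm s) (p.map ofPerm ofPerm) (q.map ofPerm ofPerm) ↔ NoInvariant s p q := by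
  have hmask : ∀ S : Finset (Fin 4), S.Nonempty → S ≠ univ →
      ∃ m ∈ List.range' 1 14, ∀ i : Fin 4, m.testBit i ↔ i ∈ S := by decide
  have hset : ∀ m ∈ List.range' 1 14, ∃ S : Finset (Fin 4), S.Nonempty ∧ S ≠ univ ∧
      ∀ i : Fin 4, m.testBit i ↔ i ∈ S := by decide
  constructor
  · intro h S hne hS
    by_contra hS'
    obtain ⟨m, hm, hmS⟩ := hmask S hne hS'
    apply h m hm
    simp only [Prod.map_fst, Prod.map_snd, preserves_ofPerm hmS]
    exact ⟨fun i hi => (hS i hi).1, fun i hi => (hS i hi).2.1, fun i hi => (hS i hi).2.2.1,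
      fun i hi => (hS i hi).2.2.2.1, fun i hi => (hS i hi).2.2.2.2⟩
  · intro h m hm hm'
    obtain ⟨S, hne, hS, hmS⟩ := hset m hm
    simp only [Prod.map_fst, Prod.map_snd, preserves_ofPerm hmS] at hm'
    obtain ⟨h₀, h₁, h₂, h₃, h₄⟩ := hm'
    exact hS (h S hne fun i hi => ⟨h₀ i hi, h₁ i hi, h₂ i hi, h₃ i hi, h₄ i hi⟩)

/-- The codes of the pairs of permutations satisfying `HandleRel` for the code `s`. -/
def handlePairs (s : PermCode) : Finset (PermCode × PermCode) :=
  (univ.image ofPerm ×ˢ univ.image ofPerm).filter (HandleRel s)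

/-- The counterpart of `transitiveTuples` for codes. -/
def tuples (s : PermCode) : Finset ((PermCode × PermCode) × PermCode × PermCode) :=
  (handlePairs s ×ˢ handlePairs s).filter fun x =>
    LinkRel s x.1 x.2 ∧ NoPreserved s x.1 x.2

lemma image_transitiveTuples (s : Perm (Fin 4)) :
    (transitiveTuples s).image
      (Prod.map (Prod.map ofPerm ofPerm) (Prod.map ofPerm ofPerm)) = tuples (ofPerm s) := by
  have handle := handleRel_map_iff ofPerm_injective ofPerm_mul ofPerm_inv s
  have link := linkRel_map_iff ofPerm_injective ofPerm_mul ofPerm_inv s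
  have key (x : (Perm (Fin 4) × Perm (Fin 4)) × Perm (Fin 4) × Perm (Fin 4)) :
      x.map (Prod.map ofPerm ofPerm) (Prod.map ofPerm ofPerm) ∈ tuples (ofPerm s) ↔
        x ∈ transitiveTuples s := by
    simp [tuples, handlePairs, transitiveTuples, handle, link, noPreserved_ofPerm]
  ext y
  rw [mem_image]
  constructor
  · rintro ⟨x, hx, rfl⟩
    exact (key x).2 hx
  · intro hy
    have hy' := hy
    simp only [tuples, handlePairs, mem_filter, mem_product, mem_image, mem_univ, true_and] at hy'
    obtain ⟨⟨⟨⟨⟨a, ha⟩, b, hb⟩, -⟩, ⟨⟨c, hc⟩, d, hd⟩, -⟩, -⟩ := hy'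
    obtain ⟨⟨_, _⟩, _, _⟩ := y
    subst ha hb hc hd
    exact ⟨((a, b), c, d), (key ((a, b), c, d)).1 hy, rfl⟩

lemma card_tuples : #(tuples (ofPerm (swap 0 1))) = 480 := by decide +kernel

end PermCode

lemma card_transitiveTuples : #(transitiveTuples (swap (0 : Fin 4) 1)) = 480 := by
  rw [← PermCode.card_tuples, ← PermCode.image_transitiveTuples, card_image_of_injective]
  have h := PermCode.ofPerm_injective
  exact (h.prodMap h).prodMap (h.prodMap h)

/-- There are exactly 480 homomorphisms φ : B → S₄ with φ(σ) = (1 2) and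
transitive image. -/
theorem stmt17 :
    Set.ncard {φ : B →* Equiv.Perm (Fin 4) |
      φ σB = Equiv.swap 0 1 ∧ ∀ i j : Fin 4, ∃ g : B, φ g i = j} = 480 := by
  have h := bijOn_transitiveTuples (swap (0 : Fin 4) 1)
  rw [← h.injOn.ncard_image, h.image_eq, Set.ncard_coe_finset, card_transitiveTuples]
end
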